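/- For every integer n ≥ 3, H(n,5) ≥ 2⌊(n−1)/3⌋ + ⌊(n−1)/2⌋; consequently also H(n,6) ≥ 2⌊(n−1)/3⌋ + ⌊(n−1)/2⌋. -/

import Mathlib

open Filter Polynomial

/-- `Γ` is a periodic orbit of the planar vector field `V`: the image of a
nonconstant periodic solution of `γ' = V ∘ γ`. -/
def IsPeriodicOrbit (V : ℝ × ℝ → ℝ × ℝ) (Γ : Set (ℝ × ℝ)) : Prop :=
  ∃ γ : ℝ → ℝ × ℝ,
    (∀ t : ℝ, HasDerivAt γ (V (γ t)) t) ∧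
    (∃ T : ℝ, 0 < T ∧ Function.Periodic γ T) ∧
    (∃ t₁ t₂ : ℝ, γ t₁ ≠ γ t₂) ∧
    Γ = Set.range γ

/-- `Γ` is a limit cycle of `V`: a periodic orbit which is isolated among
periodic orbits. -/
def IsLimitCycle (V : ℝ × ℝ → ℝ × ℝ) (Γ : Set (ℝ × ℝ)) : Prop :=
  IsPeriodicOrbit V Γ ∧
  ∃ U : Set (ℝ × ℝ), IsOpen U ∧ Γ ⊆ U ∧
    ∀ Γ' : Set (ℝ × ℝ), IsPeriodicOrbit V Γ' → Γ' ⊆ U → Γ' = Γ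

/-- The Liénard vector field `ẋ = y, ẏ = -g(x) - ε f(x) y`. -/
def lienard (f g : Polynomial ℝ) (ε : ℝ) : ℝ × ℝ → ℝ × ℝ :=
  fun p => (p.2, -(g.eval p.1) - ε * (f.eval p.1) * p.2)

/-- `HGe n m c` formalizes `H(n,m) ≥ c`: there are polynomials `f, g` with
`deg f ≤ n`, `deg g ≤ m` and `ε₀ > 0` such that for every `0 < ε ≤ ε₀` the
Liénard system has at least `c` pairwise distinct limit cycles. -/
def HGe (n m : ℕ) (c : ℝ) : Prop :=
  ∃ f g : Polynomial ℝ, f.natDegree ≤ n ∧ g.natDegree ≤ m ∧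
    ∃ ε₀ : ℝ, 0 < ε₀ ∧ ∀ ε : ℝ, 0 < ε → ε ≤ ε₀ →
      ∃ S : Finset (Set (ℝ × ℝ)),
        (∀ Γ ∈ S, IsLimitCycle (lienard f g ε) Γ) ∧ c ≤ (S.card : ℝ)

open Set Real MeasureTheory intervalIntegral Topology

/-- A solution of a time-periodic scalar equation over one period whose endpoint values agree
extends to a periodic solution. -/
lemma exists_periodic_extension {T a : ℝ} (hT : 0 < T) {v : ℝ → ℝ → ℝ}
    (hv : ∀ t x, v (t + T) x = v t x) {α : ℝ → ℝ}
    (hα : ∀ t ∈ Icc a (a + T), HasDerivWithinAt α (v t (α t)) (Icc a (a + T)) t)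
    (hend : α a = α (a + T)) :
    ∃ ρ : ℝ → ℝ, Function.Periodic ρ T ∧ (∀ t, HasDerivAt ρ (v t (ρ t)) t) ∧
      ∀ t, ∃ s ∈ Icc a (a + T), ρ t = α s := by
  set ρ : ℝ → ℝ := fun t => α (toIcoMod hT a t) with hρ
  have hper : Function.Periodic ρ T := fun t => by simp [hρ]
  have hmem : ∀ t, toIcoMod hT a t ∈ Ico a (a + T) := toIcoMod_mem_Ico hT a
  have heq : ∀ t ∈ Ico a (a + T), ρ t = α t := fun t ht => by
    simp only [hρ]; rw [(toIcoMod_eq_self hT).2 ht]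
  have hleft : ∀ t ∈ Icc (a - T) a, ρ t = α (t + T) := fun t ht => by
    rcases eq_or_lt_of_le ht.2 with h | h
    · rw [h, ← hend]; exact heq a ⟨le_rfl, by linarith⟩
    · rw [← hper t]; exact heq _ ⟨by linarith [ht.1], by linarith⟩
  have key : ∀ t ∈ Ico a (a + T), HasDerivAt ρ (v t (ρ t)) t := by
    intro t ht
    have hd := hα t ⟨ht.1, ht.2.le⟩
    rcases eq_or_lt_of_le ht.1 with h | h
    · subst h
      have ha : ρ a = α a := heq a ht
      have hr : HasDerivWithinAt ρ (v a (ρ a)) (Ici a) a := by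
        rw [ha]
        refine ((hd.mono_of_mem_nhdsWithin (Icc_mem_nhdsGE (by linarith))).congr_of_eventuallyEq
          ?_ ha)
        filter_upwards [Ico_mem_nhdsGE (show a < a + T by linarith)] with s hs using heq s hs
      have hl : HasDerivWithinAt ρ (v a (ρ a)) (Iic a) a := by
        have h1 := hα (a + T) ⟨by linarith, le_rfl⟩
        rw [hv, ← hend, ← ha] at h1
        have h2 : HasDerivWithinAt (fun s => α (s + T)) (v a (ρ a)) (Icc (a - T) a) a := by
          have h3 : HasDerivWithinAt (fun s : ℝ => s + T) 1 (Icc (a - T) a) a :=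
            ((hasDerivAt_id a).add_const T).hasDerivWithinAt
          have hm : MapsTo (fun s : ℝ => s + T) (Icc (a - T) a) (Icc a (a + T)) :=
            fun s hs => ⟨by linarith [hs.1], by linarith [hs.2]⟩
          have := h1.comp a h3 hm
          rw [mul_one] at this
          exact this
        refine ((h2.congr hleft (hleft a ⟨by linarith, le_rfl⟩)).mono_of_mem_nhdsWithin
          (Icc_mem_nhdsLE (by linarith)))
      have := hl.union hr
      rwa [Iic_union_Ici, hasDerivWithinAt_univ] at this
    · rw [heq t ht]
      refine (hd.hasDerivAt (Icc_mem_nhds h ht.2)).congr_of_eventuallyEq ?_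
      filter_upwards [Ioo_mem_nhds h ht.2] with s hs using heq s ⟨hs.1.le, hs.2⟩
  refine ⟨ρ, hper, fun t => ?_, fun t => ⟨_, Ico_subset_Icc_self (hmem t), rfl⟩⟩
  have h1 := key _ (hmem t)
  have h2 : ∀ s, ρ (s - toIcoDiv hT a t • T) = ρ s := fun s => hper.sub_zsmul_eq _
  have h3 : ∀ x, v (t - toIcoDiv hT a t • T) x = v t x := fun x =>
    Function.Periodic.sub_zsmul_eq (f := fun s => v s x) (fun s => hv s x) _
  rw [← self_sub_toIcoDiv_zsmul] at h1
  have h4 := h1.comp_sub_const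
  rw [h2, h3] at h4
  simpa only [h2] using h4

/-- A periodic function with nonnegative derivative has zero derivative. -/
lemma deriv_eq_zero_of_periodic_of_nonneg {V V' : ℝ → ℝ} {T : ℝ} (hT : 0 < T)
    (hV : ∀ t, HasDerivAt V (V' t) t) (hper : Function.Periodic V T) (h0 : ∀ t, 0 ≤ V' t) (t : ℝ) :
    V' t = 0 := by
  have hmono : Monotone V := monotone_of_deriv_nonneg (fun s => (hV s).differentiableAt)
    (fun s => by rw [(hV s).deriv]; exact h0 s)
  have hconst : ∀ s, V s = V t := by
    intro s
    apply le_antisymm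
    · obtain ⟨n, hn⟩ := exists_nat_gt ((s - t) / T)
      rw [div_lt_iff₀ hT] at hn
      rw [← hper.nat_mul n t]
      exact hmono (by linarith)
    · obtain ⟨n, hn⟩ := exists_nat_gt ((t - s) / T)
      rw [div_lt_iff₀ hT] at hn
      rw [← hper.nat_mul n s]
      exact hmono (by linarith)
  have : V = fun _ => V t := funext hconst
  exact (hV t).unique (this ▸ hasDerivAt_const t (V t))

/-- Existence half of the averaging principle: a slowly varying periodic scalar equation, whose
mean is close to a nondegenerate affine function vanishing at `r₀`, has a periodic solution
near `r₀`. -/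
lemma exists_periodic_solution_of_average {H : ℝ → ℝ → ℝ} {A h₀ : ℝ → ℝ}
    {r₀ η κ κ₂ C ε s : ℝ} (hη : 0 < η) (hκ : 0 < κ) (hκ₂ : 0 ≤ κ₂) (hε : 0 < ε)
    (hs : s = 1 ∨ s = -1)
    (hper : ∀ t r, H (t + 2 * π) r = H t r)
    (hcont : ∀ r, |r - r₀| ≤ η → Continuous (fun t => H t r))
    (hA : Continuous A) (hh : Continuous h₀) (hAC : ∀ t, |A t| ≤ C) (hhC : ∀ t, |h₀ t| ≤ C)
    (hE₁ : ∀ t r₁ r₂, |r₁ - r₀| ≤ η → |r₂ - r₀| ≤ η →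
      |H t r₂ - H t r₁ - A t * (r₂ - r₁)| ≤ κ * |r₂ - r₁|)
    (hE₂ : ∀ t, |H t r₀ - h₀ t| ≤ κ₂)
    (integral_h₀ : ∫ t in -π..π, h₀ t = 0) (integral_A : ∫ t in -π..π, A t = 4 * π * κ * s)
    (hsmall₁ : 2 * π * (ε * (C + κ₂ + (C + κ) * η)) < η / 2)
    (hsmall₂ : κ₂ + (C + κ) * (2 * π * (ε * (C + κ₂ + (C + κ) * η))) < κ * (η / 2)) :
    ∃ ρ : ℝ → ℝ, Function.Periodic ρ (2 * π) ∧ (∀ t, HasDerivAt ρ (ε * H t (ρ t)) t) ∧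
      ∀ t, |ρ t - r₀| < η := by
  have hπ := Real.pi_pos
  have hC : 0 ≤ C := (abs_nonneg _).trans (hAC 0)
  set L := C + κ₂ + (C + κ) * η with hL
  have hL0 : 0 ≤ L := by positivity
  set c : ℝ → ℝ := fun x => max (r₀ - η) (min (r₀ + η) x) with hc
  have hcI : ∀ x, |c x - r₀| ≤ η := fun x => by
    rw [abs_le]
    constructor
    · have : r₀ - η ≤ c x := le_max_left _ _
      linarith
    · have : c x ≤ r₀ + η := max_le (by linarith) (min_le_left _ _)
      linarith
  have hcL : ∀ x y, |c x - c y| ≤ |x - y| := fun x y => by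
    refine (abs_max_sub_max_le_max _ _ _ _).trans (max_le (by simp) ?_)
    exact (abs_min_sub_min_le_max _ _ _ _).trans (max_le (by simp) le_rfl)
  have hcid : ∀ x, |x - r₀| ≤ η → c x = x := fun x hx => by
    rw [abs_le] at hx
    simp only [hc]
    rw [min_eq_right (by linarith), max_eq_right (by linarith)]
  have hHL : ∀ t r, |r - r₀| ≤ η → |H t r| ≤ L := fun t r hr => by
    have h1 := hE₁ t r₀ r (by simpa using hη.le) hr
    have h2 := hE₂ t
    have h3 : |A t * (r - r₀)| ≤ C * η := by
      rw [abs_mul]; exact mul_le_mul (hAC t) hr (abs_nonneg _) hC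
    have h4 : κ * |r - r₀| ≤ κ * η := by gcongr
    have h5 := hhC t
    rw [abs_le] at h1 h2 h3 h5 ⊢
    constructor <;> rw [hL] <;> linarith
  have hHLip : ∀ t r₁ r₂, |r₁ - r₀| ≤ η → |r₂ - r₀| ≤ η →
      |H t r₁ - H t r₂| ≤ (C + κ) * |r₁ - r₂| := fun t r₁ r₂ h₁ h₂ => by
    have h1 := hE₁ t r₂ r₁ h₂ h₁
    have h3 : |A t * (r₁ - r₂)| ≤ C * |r₁ - r₂| := by
      rw [abs_mul]; gcongr; exact hAC t
    rw [abs_le] at h1 h3 ⊢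
    constructor <;> linarith
  set v : ℝ → ℝ → ℝ := fun t x => ε * H t (c x) with hv
  have hvL : ∀ t x, |v t x| ≤ ε * L := fun t x => by
    simp only [hv]; rw [abs_mul, abs_of_pos hε]; gcongr; exact hHL _ _ (hcI x)
  have hPL : IsPicardLindelof v (tmin := -π) (tmax := π) ⟨-π, le_rfl, by linarith⟩ r₀
      η.toNNReal (η / 2).toNNReal (ε * L).toNNReal (ε * (C + κ)).toNNReal := by
    refine ⟨fun t _ => LipschitzOnWith.of_dist_le_mul fun x _ y _ => ?_, fun x _ => ?_,
      fun t _ x _ => (hvL t x).trans (Real.le_coe_toNNReal _), ?_⟩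
    · rw [Real.coe_toNNReal _ (by positivity)]
      simp only [Real.dist_eq, hv]
      rw [← mul_sub, abs_mul, abs_of_pos hε, mul_assoc]
      gcongr
      exact (hHLip t _ _ (hcI x) (hcI y)).trans
        (mul_le_mul_of_nonneg_left (hcL x y) (by positivity))
    · exact (continuous_const.mul (hcont _ (hcI x))).continuousOn
    · rw [Real.coe_toNNReal _ hη.le, Real.coe_toNNReal _ (by positivity),
        Real.coe_toNNReal _ (by positivity)]
      simp only
      rw [max_eq_left (by linarith)]
      linarith
  obtain ⟨α, hα, hαc⟩ := hPL.exists_forall_mem_closedBall_eq_hasDerivWithinAt_continuousOn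
  rw [Real.coe_toNNReal _ (by positivity)] at hα hαc
  have hball : ∀ x, x ∈ Metric.closedBall r₀ (η / 2) ↔ |x - r₀| ≤ η / 2 := fun x => by
    rw [Metric.mem_closedBall, Real.dist_eq]
  set d := 2 * π * (ε * L) with hd
  have hd0 : 0 ≤ d := by positivity
  have hdrift : ∀ x, |x - r₀| ≤ η / 2 → ∀ t ∈ Icc (-π) π, |α (x, t) - x| ≤ d := by
    intro x hx t ht
    obtain ⟨h0, h1⟩ := hα x ((hball x).2 hx)
    have := (convex_Icc (-π) π).norm_image_sub_le_of_norm_hasDerivWithin_le h1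
      (fun t _ => hvL t _) (left_mem_Icc.2 (by linarith)) ht
    simp only [h0, Real.norm_eq_abs] at this
    refine this.trans ?_
    rw [abs_of_nonneg (by linarith [ht.1]), hd, mul_comm (2 * π)]
    gcongr
    linarith [ht.2]
  have hin : ∀ x, |x - r₀| ≤ η / 2 → ∀ t ∈ Icc (-π) π, |α (x, t) - r₀| < η := by
    intro x hx t ht
    have h1 := hdrift x hx t ht
    rw [abs_le] at h1 hx
    rw [abs_lt]
    constructor <;> linarith
  have hdisp : ∀ σ : ℝ, (σ = 1 ∨ σ = -1) →
      0 < s * σ * (α (r₀ + σ * (η / 2), π) - (r₀ + σ * (η / 2))) := by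
    intro σ hσ
    have hσ1 : |σ| = 1 := by rcases hσ with rfl | rfl <;> simp
    have hs1 : |s| = 1 := by rcases hs with rfl | rfl <;> simp
    set x := r₀ + σ * (η / 2) with hx
    have hxr : |x - r₀| = η / 2 := by
      rw [hx, add_sub_cancel_left, abs_mul, hσ1, one_mul, abs_of_pos (by positivity)]
    obtain ⟨h0, h1⟩ := hα x ((hball x).2 hxr.le)
    set u : ℝ → ℝ := fun t => h₀ t + A t * (σ * (η / 2)) with hu
    have hucont : Continuous u := by fun_prop
    set B := κ₂ + (C + κ) * d + κ * (η / 2) with hB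
    have hpt : ∀ t ∈ Icc (-π) π, |v t (α (x, t)) - ε * u t| ≤ ε * B := by
      intro t ht
      have hi := hin x hxr.le t ht
      have hdr := hdrift x hxr.le t ht
      simp only [hv, hu]
      rw [hcid _ hi.le, ← mul_sub, abs_mul, abs_of_pos hε]
      gcongr
      have e1 := hE₁ t r₀ (α (x, t)) (by simpa using hη.le) hi.le
      have e2 := hE₂ t
      have e3 : |A t * (α (x, t) - x)| ≤ C * d := by
        rw [abs_mul]; exact mul_le_mul (hAC t) hdr (abs_nonneg _) hC
      have e4 : κ * |α (x, t) - r₀| ≤ κ * (d + η / 2) := by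
        gcongr
        rw [show α (x, t) - r₀ = (α (x, t) - x) + (x - r₀) by ring]
        exact (abs_add_le _ _).trans (by rw [hxr]; linarith)
      have e5 : A t * (α (x, t) - r₀) = A t * (α (x, t) - x) + A t * (σ * (η / 2)) := by
        rw [hx]; ring
      rw [abs_le] at e1 e2 e3 ⊢
      constructor <;> rw [hB] <;> linarith
    have hder : ∀ t ∈ Icc (-π) π, HasDerivWithinAt
        (fun t => α (x, t) - ε * ∫ τ in -π..t, u τ) (v t (α (x, t)) - ε * u t) (Icc (-π) π) t := by
      intro t ht
      exact (h1 t ht).sub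
        ((hucont.integral_hasStrictDerivAt _ t).hasDerivAt.hasDerivWithinAt.const_mul ε)
    have hmv := (convex_Icc (-π) π).norm_image_sub_le_of_norm_hasDerivWithin_le hder
      hpt (left_mem_Icc.2 (by linarith)) (right_mem_Icc.2 (by linarith))
    have hui : ∫ τ in -π..π, u τ = 4 * π * κ * s * (σ * (η / 2)) := by
      simp only [hu]
      rw [intervalIntegral.integral_add (hh.intervalIntegrable _ _)
        ((show Continuous fun t => A t * (σ * (η / 2)) by fun_prop).intervalIntegrable _ _), integral_h₀,
        intervalIntegral.integral_mul_const, integral_A, zero_add]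
    simp only [h0, hui, intervalIntegral.integral_same, mul_zero, sub_zero, Real.norm_eq_abs] at hmv
    rw [show |π - -π| = 2 * π by rw [abs_of_pos (by linarith)]; ring] at hmv
    have hBlt : B < 2 * κ * (η / 2) := by rw [hB]; linarith
    set X := α (x, π) with hX
    have hss : s * s = 1 := by rcases hs with rfl | rfl <;> norm_num
    have hσσ : σ * σ = 1 := by rcases hσ with rfl | rfl <;> norm_num
    have e1 : |s * σ * (X - ε * (4 * π * κ * s * (σ * (η / 2))) - x)| ≤ ε * B * (2 * π) := by
      rw [abs_mul, abs_mul, hs1, hσ1, one_mul, one_mul]; exact hmv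
    have e2 : s * σ * (X - ε * (4 * π * κ * s * (σ * (η / 2))) - x)
        = s * σ * (X - x) - ε * (2 * π) * (2 * κ * (η / 2)) := by
      linear_combination (-(ε * 4 * π * κ * (η / 2))) * (σ * σ * hss + hσσ)
    rw [e2] at e1
    have e3 : ε * (2 * π) * B < ε * (2 * π) * (2 * κ * (η / 2)) := by gcongr
    have := (abs_le.1 e1).1
    linarith
  have hPc : ContinuousOn (fun x => α (x, π) - x) (Icc (r₀ - η / 2) (r₀ + η / 2)) := by
    refine ContinuousOn.sub (hαc.comp (by fun_prop) fun x hx => ⟨(hball x).2 ?_, ?_⟩)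
      continuousOn_id
    · rw [abs_le]; constructor <;> linarith [hx.1, hx.2]
    · exact right_mem_Icc.2 (by linarith)
  have hp := hdisp 1 (Or.inl rfl)
  have hm := hdisp (-1) (Or.inr rfl)
  rw [show r₀ + 1 * (η / 2) = r₀ + η / 2 by ring] at hp
  rw [show r₀ + -1 * (η / 2) = r₀ - η / 2 by ring] at hm
  obtain ⟨x, hx, hfix⟩ : ∃ x ∈ Icc (r₀ - η / 2) (r₀ + η / 2), α (x, π) - x = 0 := by
    rcases hs with rfl | rfl
    · exact intermediate_value_Icc (by linarith) hPc ⟨by linarith, by linarith⟩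
    · exact intermediate_value_Icc' (by linarith) hPc ⟨by linarith, by linarith⟩
  have hxr : |x - r₀| ≤ η / 2 := by rw [abs_le]; constructor <;> linarith [hx.1, hx.2]
  obtain ⟨h0, h1⟩ := hα x ((hball x).2 hxr)
  obtain ⟨ρ, hρ1, hρ2, hρ3⟩ := exists_periodic_extension (T := 2 * π) (a := -π) (v := v)
    (α := fun t => α (x, t)) (by positivity) (fun t y => by simp only [hv, hper])
    (by rw [show -π + 2 * π = π by ring]; exact h1)
    (by rw [show -π + 2 * π = π by ring]; simp only [h0]; linarith)
  have hρ4 : ∀ t, |ρ t - r₀| < η := fun t => by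
    obtain ⟨τ, hτ, e⟩ := hρ3 t
    rw [show -π + 2 * π = π by ring] at hτ
    rw [e]; exact hin x hxr τ hτ
  refine ⟨ρ, hρ1, fun t => ?_, hρ4⟩
  have := hρ2 t
  simp only [hv] at this
  rwa [hcid _ (hρ4 t).le] at this

/-- Uniqueness half of the averaging principle: any motion near `r₀` which returns to its initial
position after some time stays on the given periodic solution. -/
lemma eq_periodic_solution_of_average {H : ℝ → ℝ → ℝ} {A : ℝ → ℝ}
    {r₀ η κ ε s : ℝ} (hκ : 0 < κ) (hε : 0 < ε) (hs : s = 1 ∨ s = -1)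
    (hA : Continuous A) (hAper : Function.Periodic A (2 * π))
    (hE₁ : ∀ t r₁ r₂, |r₁ - r₀| ≤ η → |r₂ - r₀| ≤ η →
      |H t r₂ - H t r₁ - A t * (r₂ - r₁)| ≤ κ * |r₂ - r₁|)
    (integral_A : ∫ t in -π..π, A t = 4 * π * κ * s)
    {ρ : ℝ → ℝ} (hρper : Function.Periodic ρ (2 * π)) (hρ : ∀ t, HasDerivAt ρ (ε * H t (ρ t)) t)
    (hρr : ∀ t, |ρ t - r₀| ≤ η)
    {θ r ω : ℝ → ℝ} {T : ℝ} (hT : 0 < T) (hω : ∀ t, 0 < ω t) (hθ : ∀ t, HasDerivAt θ (ω t) t)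
    (hr : ∀ t, HasDerivAt r (ω t * (ε * H (θ t) (r t))) t) (hrr : ∀ t, |r t - r₀| ≤ η)
    (hrper : Function.Periodic r T) (hθper : ∀ t, ∃ k : ℤ, θ (t + T) = θ t + k * (2 * π)) (t : ℝ) :
    r t = ρ (θ t) := by
  have hπ := Real.pi_pos
  set a : ℝ → ℝ := fun τ => A τ - 2 * κ * s with ha
  have hac : Continuous a := by fun_prop
  set E : ℝ → ℝ := fun τ => ∫ x in (0:ℝ)..τ, a x with hEdef
  have hE : ∀ τ, HasDerivAt E (a τ) τ := fun τ => (hac.integral_hasStrictDerivAt _ τ).hasDerivAt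
  have haper : Function.Periodic a (2 * π) := fun τ => by simp only [ha, hAper τ]
  have hEper : Function.Periodic E (2 * π) := by
    intro τ
    have h1 : ∫ x in τ..τ + 2 * π, a x = 0 := by
      rw [haper.intervalIntegral_add_eq τ (-π), show -π + 2 * π = π by ring]
      simp only [ha]
      rw [intervalIntegral.integral_sub (hA.intervalIntegrable _ _) (by simp), integral_A]
      simp
      ring
    simp only [hEdef]
    rw [← intervalIntegral.integral_add_adjacent_intervals (hac.intervalIntegrable 0 τ)
      (hac.intervalIntegrable τ (τ + 2 * π)), h1, add_zero]
  set w : ℝ → ℝ := fun τ => r τ - ρ (θ τ) with hw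
  have hwd : ∀ τ, HasDerivAt w (ω τ * (ε * (H (θ τ) (r τ) - H (θ τ) (ρ (θ τ))))) τ := fun τ => by
    have := (hr τ).sub ((hρ (θ τ)).comp τ (hθ τ))
    exact this.congr_deriv (by ring)
  set e : ℝ → ℝ := fun τ => H (θ τ) (r τ) - H (θ τ) (ρ (θ τ)) - A (θ τ) * w τ with he
  set V : ℝ → ℝ := fun τ => s * (w τ ^ 2 * exp (-2 * ε * E (θ τ))) with hV
  set V' : ℝ → ℝ := fun τ => exp (-2 * ε * E (θ τ)) * (2 * ω τ * ε) *
    (2 * κ * (s * s) * w τ ^ 2 + s * (e τ * w τ)) with hV'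
  have hVd : ∀ τ, HasDerivAt V (V' τ) τ := fun τ => by
    have h1 := (((hE (θ τ)).comp τ (hθ τ)).const_mul (-2 * ε)).exp
    have h2 := (((hwd τ).pow 2).mul h1).const_mul s
    refine h2.congr_deriv ?_
    simp only [hV', he, ha, Function.comp_apply, Pi.pow_apply]
    push_cast
    ring
  have hss : s * s = 1 := by rcases hs with rfl | rfl <;> norm_num
  have hs1 : |s| = 1 := by rcases hs with rfl | rfl <;> simp
  have hbound : ∀ τ, κ * w τ ^ 2 ≤ 2 * κ * (s * s) * w τ ^ 2 + s * (e τ * w τ) := fun τ => by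
    have h1 : |s * (e τ * w τ)| ≤ κ * w τ ^ 2 := by
      rw [abs_mul, hs1, one_mul, abs_mul, ← sq_abs (w τ), sq, ← mul_assoc]
      gcongr
      exact hE₁ _ _ _ (hρr _) (hrr _)
    rw [hss]
    linarith [(abs_le.1 h1).1]
  have hV0 : ∀ τ, 0 ≤ V' τ := fun τ => by
    have h1 : 0 ≤ κ * w τ ^ 2 := by positivity
    have h2 := hω τ
    exact mul_nonneg (by positivity) (h1.trans (hbound τ))
  have hVper : Function.Periodic V T := fun τ => by
    obtain ⟨k, hk⟩ := hθper τ
    simp only [hV, hw, hk, hrper τ, hρper.int_mul k _, hEper.int_mul k _]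
  have hz := deriv_eq_zero_of_periodic_of_nonneg hT hVd hVper hV0 t
  simp only [hV'] at hz
  have h2 := hω t
  have h3 : 0 < exp (-2 * ε * E (θ t)) * (2 * ω t * ε) := by positivity
  have h4 := (mul_eq_zero.1 hz).resolve_left h3.ne'
  have h5 := hbound t
  have h6 : w t ^ 2 = 0 := by
    have : 0 ≤ w t ^ 2 := sq_nonneg _
    nlinarith
  have h7 : w t = 0 := by simpa using h6
  simp only [hw] at h7
  linarith

/-- Radial equation `dr/dθ = ε * radialField Φ ε (sin θ) (cos θ) r` of the Liénard system
`ξ' = Y - ε Φ(ξ)`, `Y' = -ξ` in polar coordinates `ξ = r sin θ`, `Y = r cos θ`. -/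
noncomputable def radialField (Φ : ℝ → ℝ) (ε s c r : ℝ) : ℝ :=
  -(Φ (r * s) * (r * s)) / (r - ε * Φ (r * s) * c)

section radialField

variable {Φ Φ' : ℝ → ℝ} {R r₀ : ℝ}

lemma radialField_eventually (hΦ : ∀ ξ, |ξ| < R → HasDerivAt Φ (Φ' ξ) ξ)
    (hΦ' : ∀ ξ, |ξ| < R → ContinuousAt Φ' ξ) (hr₀ : 0 < r₀) (hrR : r₀ < R) {κ : ℝ} (hκ : 0 < κ) :
    ∃ δ > 0, ∀ ε, |ε| < δ → ∀ s ∈ Icc (-1 : ℝ) 1, ∀ c ∈ Icc (-1 : ℝ) 1,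
      (∀ r, |r - r₀| < δ → 0 < r ∧ r < R ∧ 0 < r - ε * Φ (r * s) * c) ∧
      ∀ r₁ r₂, |r₁ - r₀| < δ → |r₂ - r₀| < δ →
        |radialField Φ ε s c r₂ - radialField Φ ε s c r₁ - -(Φ' (r₀ * s) * s ^ 2) * (r₂ - r₁)|
          ≤ κ * |r₂ - r₁| := by
  set D : ℝ × ℝ → ℝ × ℝ → ℝ := fun p z =>
    (-((Φ' (p.2 * z.1) * z.1) * (p.2 * z.1) + Φ (p.2 * z.1) * z.1) *
        (p.2 - p.1 * Φ (p.2 * z.1) * z.2)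
      - -(Φ (p.2 * z.1) * (p.2 * z.1)) * (1 - p.1 * (Φ' (p.2 * z.1) * z.1) * z.2)) /
        (p.2 - p.1 * Φ (p.2 * z.1) * z.2) ^ 2 with hD
  have hlt : ∀ r s : ℝ, s ∈ Icc (-1 : ℝ) 1 → 0 < r → r < R → |r * s| < R := fun r s hs h1 h2 => by
    rw [abs_mul, abs_of_pos h1]
    have : |s| ≤ 1 := abs_le.2 hs
    nlinarith [abs_nonneg s]
  have hK : IsCompact (Icc (-1 : ℝ) 1 ×ˢ Icc (-1 : ℝ) 1) := isCompact_Icc.prod isCompact_Icc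
  have hev : ∀ᶠ p : ℝ × ℝ in 𝓝 (0, r₀), ∀ z ∈ Icc (-1 : ℝ) 1 ×ˢ Icc (-1 : ℝ) 1,
      0 < p.2 ∧ p.2 < R ∧ 0 < p.2 - p.1 * Φ (p.2 * z.1) * z.2 ∧
        |D p z - -(Φ' (r₀ * z.1) * z.1 ^ 2)| < κ := by
    apply hK.eventually_forall_of_forall_eventually
    rintro ⟨s, c⟩ ⟨hs, hc⟩
    simp only at hs hc
    have hm := hlt r₀ s hs hr₀ hrR
    have c7 : ContinuousAt (fun p : (ℝ × ℝ) × (ℝ × ℝ) => p.1.2) ((0, r₀), (s, c)) := by fun_prop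
    have b1 : ContinuousAt (fun p : (ℝ × ℝ) × (ℝ × ℝ) => p.1.1) ((0, r₀), (s, c)) := by fun_prop
    have z1 : ContinuousAt (fun p : (ℝ × ℝ) × (ℝ × ℝ) => p.2.1) ((0, r₀), (s, c)) := by fun_prop
    have z2 : ContinuousAt (fun p : (ℝ × ℝ) × (ℝ × ℝ) => p.2.2) ((0, r₀), (s, c)) := by fun_prop
    have c1 : ContinuousAt (fun p : (ℝ × ℝ) × (ℝ × ℝ) => p.1.2 * p.2.1) ((0, r₀), (s, c)) := by
      fun_prop
    have c2 : ContinuousAt (fun p : (ℝ × ℝ) × (ℝ × ℝ) => Φ (p.1.2 * p.2.1)) ((0, r₀), (s, c)) :=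
      ContinuousAt.comp (g := Φ) (hΦ _ hm).continuousAt c1
    have c3 : ContinuousAt (fun p : (ℝ × ℝ) × (ℝ × ℝ) => Φ' (p.1.2 * p.2.1)) ((0, r₀), (s, c)) :=
      ContinuousAt.comp (g := Φ') (hΦ' _ hm) c1
    have c3' : ContinuousAt (fun p : (ℝ × ℝ) × (ℝ × ℝ) => Φ' (r₀ * p.2.1)) ((0, r₀), (s, c)) :=
      ContinuousAt.comp (g := Φ') (hΦ' _ hm) (by fun_prop)
    have c4 : ContinuousAt (fun p : (ℝ × ℝ) × (ℝ × ℝ) =>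
        p.1.2 - p.1.1 * Φ (p.1.2 * p.2.1) * p.2.2) ((0, r₀), (s, c)) := c7.sub ((b1.mul c2).mul z2)
    have c5 : ContinuousAt (fun p : (ℝ × ℝ) × (ℝ × ℝ) => D p.1 p.2) ((0, r₀), (s, c)) := by
      refine ContinuousAt.div ?_ (c4.pow 2) (by simpa using hr₀.ne')
      exact ((((c3.mul z1).mul c1).add (c2.mul z1)).neg.mul c4).sub
        ((c2.mul c1).neg.mul (continuousAt_const.sub ((b1.mul (c3.mul z1)).mul z2)))
    have c6 : ContinuousAt (fun p : (ℝ × ℝ) × (ℝ × ℝ) =>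
        |D p.1 p.2 - -(Φ' (r₀ * p.2.1) * p.2.1 ^ 2)|) ((0, r₀), (s, c)) := by fun_prop
    have e0 : |D (0, r₀) (s, c) - -(Φ' (r₀ * s) * s ^ 2)| < κ := by
      have : D (0, r₀) (s, c) - -(Φ' (r₀ * s) * s ^ 2) = 0 := by
        have hne := hr₀.ne'
        simp only [hD, zero_mul, sub_zero]
        field_simp
        ring
      rw [this, abs_zero]
      exact hκ
    exact (c7.eventually_const_lt hr₀).and ((c7.eventually_lt_const hrR).and
      ((c4.eventually_const_lt (by simpa using hr₀)).and (c6.eventually_lt_const e0)))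
  obtain ⟨δ, hδ, hball⟩ := Metric.eventually_nhds_iff.1 hev
  have hP : ∀ ε, |ε| < δ → ∀ r, |r - r₀| < δ → ∀ z ∈ Icc (-1 : ℝ) 1 ×ˢ Icc (-1 : ℝ) 1,
      0 < r ∧ r < R ∧ 0 < r - ε * Φ (r * z.1) * z.2 ∧
        |D (ε, r) z - -(Φ' (r₀ * z.1) * z.1 ^ 2)| < κ := fun ε hε r hr z hz => by
    refine hball (y := (ε, r)) ?_ z hz
    rw [Prod.dist_eq]
    simpa [Real.dist_eq] using ⟨hε, hr⟩
  refine ⟨δ, hδ, fun ε hε s hs c hc => ⟨fun r hr => ?_, fun r₁ r₂ h₁ h₂ => ?_⟩⟩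
  · obtain ⟨a1, a2, a3, -⟩ := hP ε hε r hr (s, c) ⟨hs, hc⟩
    exact ⟨a1, a2, a3⟩
  · have hder : ∀ r ∈ Metric.ball r₀ δ, HasDerivWithinAt
        (fun r => radialField Φ ε s c r - -(Φ' (r₀ * s) * s ^ 2) * r)
        (D (ε, r) (s, c) - -(Φ' (r₀ * s) * s ^ 2)) (Metric.ball r₀ δ) r := by
      intro r hr
      rw [Metric.mem_ball, Real.dist_eq] at hr
      obtain ⟨a1, a2, a3, -⟩ := hP ε hε r hr (s, c) ⟨hs, hc⟩
      have d0 : HasDerivAt (fun r : ℝ => r * s) s r := by simpa using (hasDerivAt_id r).mul_const s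
      have d1 : HasDerivAt (fun r : ℝ => Φ (r * s)) (Φ' (r * s) * s) r :=
        HasDerivAt.comp (h₂ := Φ) r (hΦ _ (hlt r s hs a1 a2)) d0
      have d2 := (d1.mul d0).neg
      have d3 := (hasDerivAt_id r).sub ((d1.const_mul ε).mul_const c)
      have d4 := d2.div d3 a3.ne'
      have d5 := (hasDerivAt_id r).const_mul (-(Φ' (r₀ * s) * s ^ 2))
      rw [mul_one] at d5
      refine ((d4.sub d5).congr_deriv ?_).hasDerivWithinAt
      simp only [hD, Pi.mul_apply, Pi.neg_apply, id, Pi.sub_apply]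
    have := (convex_ball r₀ δ).norm_image_sub_le_of_norm_hasDerivWithin_le hder
      (C := κ) (fun r hr => by
        rw [Metric.mem_ball, Real.dist_eq] at hr
        exact (hP ε hε r hr (s, c) ⟨hs, hc⟩).2.2.2.le)
      (show r₁ ∈ Metric.ball r₀ δ by rwa [Metric.mem_ball, Real.dist_eq])
      (show r₂ ∈ Metric.ball r₀ δ by rwa [Metric.mem_ball, Real.dist_eq])
    simp only [Real.norm_eq_abs] at this
    convert this using 2
    ring

lemma radialField_eventually_close (hΦ : ∀ ξ, |ξ| < R → ContinuousAt Φ ξ)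
    (hr₀ : 0 < r₀) (hrR : r₀ < R) {κ : ℝ} (hκ : 0 < κ) :
    ∃ δ > 0, ∀ ε, |ε| < δ → ∀ s ∈ Icc (-1 : ℝ) 1, ∀ c ∈ Icc (-1 : ℝ) 1,
      |radialField Φ ε s c r₀ - -(Φ (r₀ * s) * s)| ≤ κ := by
  have hK : IsCompact (Icc (-1 : ℝ) 1 ×ˢ Icc (-1 : ℝ) 1) := isCompact_Icc.prod isCompact_Icc
  have hev : ∀ᶠ ε : ℝ in 𝓝 0, ∀ z ∈ Icc (-1 : ℝ) 1 ×ˢ Icc (-1 : ℝ) 1,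
      |radialField Φ ε z.1 z.2 r₀ - -(Φ (r₀ * z.1) * z.1)| < κ := by
    apply hK.eventually_forall_of_forall_eventually
    rintro ⟨s, c⟩ ⟨hs, hc⟩
    simp only at hs hc
    have hm : |r₀ * s| < R := by
      rw [abs_mul, abs_of_pos hr₀]
      have : |s| ≤ 1 := abs_le.2 hs
      nlinarith [abs_nonneg s]
    have c2 : ContinuousAt (fun p : ℝ × (ℝ × ℝ) => Φ (r₀ * p.2.1)) (0, (s, c)) :=
      ContinuousAt.comp (g := Φ) (hΦ _ hm) (by fun_prop)
    have c5 : ContinuousAt (fun p : ℝ × (ℝ × ℝ) => radialField Φ p.1 p.2.1 p.2.2 r₀)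
        (0, (s, c)) := by
      refine ContinuousAt.div (by fun_prop) (by fun_prop) (by simpa using hr₀.ne')
    have c6 : ContinuousAt (fun p : ℝ × (ℝ × ℝ) =>
        |radialField Φ p.1 p.2.1 p.2.2 r₀ - -(Φ (r₀ * p.2.1) * p.2.1)|) (0, (s, c)) := by fun_prop
    refine c6.eventually_lt_const ?_
    have : radialField Φ 0 s c r₀ - -(Φ (r₀ * s) * s) = 0 := by
      have hne := hr₀.ne'
      simp only [radialField, zero_mul, sub_zero]
      field_simp
      ring
    simp only [this, abs_zero]
    exact hκ
  obtain ⟨δ, hδ, hball⟩ := Metric.eventually_nhds_iff.1 hev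
  refine ⟨δ, hδ, fun ε hε s hs c hc => (hball ?_ (s, c) ⟨hs, hc⟩).le⟩
  simpa [Real.dist_eq] using hε

end radialField

/-- Between `a` and `b`, the polynomial `q` is an increasing coordinate, whose inverse is `φ`
on `|ξ| < R`. For the Hamiltonian `y² / 2 + q(x)² / 2` this describes a potential well. -/
structure Well (q : ℝ[X]) (a b R : ℝ) (φ : ℝ → ℝ) : Prop where
  mem : ∀ ξ, |ξ| < R → φ ξ ∈ Ioo a b
  eval : ∀ ξ, |ξ| < R → q.eval (φ ξ) = ξ
  inv : ∀ x ∈ Ioo a b, |q.eval x| < R → φ (q.eval x) = x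
  deriv_pos : ∀ x ∈ Ioo a b, 0 < q.derivative.eval x

lemma exists_well {q : ℝ[X]} {a b R : ℝ} (hab : a ≤ b)
    (hd : ∀ x ∈ Ioo a b, 0 < q.derivative.eval x) (ha : q.eval a ≤ -R) (hb : R ≤ q.eval b) :
    ∃ φ, Well q a b R φ := by
  have hmono : StrictMonoOn (fun x => q.eval x) (Icc a b) := by
    apply strictMonoOn_of_deriv_pos (convex_Icc a b) q.continuous.continuousOn
    intro x hx
    rw [interior_Icc] at hx
    rw [Polynomial.deriv]
    exact hd x hx
  have hex : ∀ ξ, ∃ x, |ξ| < R → x ∈ Ioo a b ∧ q.eval x = ξ := fun ξ => by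
    by_cases h : |ξ| < R
    · have h' := abs_lt.1 h
      obtain ⟨x, hx, hx'⟩ := intermediate_value_Ioo hab q.continuous.continuousOn
        (show ξ ∈ Ioo (q.eval a) (q.eval b) from ⟨by linarith [h'.1], by linarith [h'.2]⟩)
      exact ⟨x, fun _ => ⟨hx, hx'⟩⟩
    · exact ⟨0, fun h' => absurd h' h⟩
  choose φ hφ using hex
  refine ⟨φ, fun ξ h => (hφ ξ h).1, fun ξ h => (hφ ξ h).2, fun x hx h => ?_, hd⟩
  exact hmono.injOn (Ioo_subset_Icc_self (hφ _ h).1) (Ioo_subset_Icc_self hx) (hφ _ h).2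

/-- First order Melnikov function of the well with inverse coordinate `φ`. -/
noncomputable def melnikov (φ : ℝ → ℝ) (F : ℝ[X]) (r : ℝ) : ℝ :=
  ∫ θ in -π..π, F.eval (φ (r * sin θ)) * sin θ

/-- The derivative of `melnikov φ F`. -/
noncomputable def melnikovDeriv (q : ℝ[X]) (φ : ℝ → ℝ) (F : ℝ[X]) (r : ℝ) : ℝ :=
  ∫ θ in -π..π, F.derivative.eval (φ (r * sin θ)) / q.derivative.eval (φ (r * sin θ)) * sin θ ^ 2

lemma abs_mul_sin_lt {r R : ℝ} (h0 : 0 < r) (hr : r < R) (θ : ℝ) : |r * sin θ| < R := by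
  rw [abs_mul, abs_of_pos h0]
  nlinarith [abs_sin_le_one θ, abs_nonneg (sin θ)]

namespace Well

variable {q : ℝ[X]} {a b R : ℝ} {φ : ℝ → ℝ}

lemma hasDerivAt (hw : Well q a b R φ) {ξ : ℝ} (hξ : |ξ| < R) :
    HasDerivAt φ (q.derivative.eval (φ ξ))⁻¹ ξ := by
  have h1 : HasStrictDerivAt (fun x => q.eval x) (q.derivative.eval (φ ξ)) (φ ξ) :=
    q.hasStrictDerivAt _
  have hev : ∀ᶠ x in 𝓝 (φ ξ), φ (q.eval x) = x := by
    have h2 : ∀ᶠ x in 𝓝 (φ ξ), |q.eval x| < R :=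
      (continuous_abs.comp q.continuous).continuousAt.eventually_lt_const
        (by simpa [hw.eval ξ hξ] using hξ)
    filter_upwards [h2, Ioo_mem_nhds (hw.mem ξ hξ).1 (hw.mem ξ hξ).2] with x h3 h4
    exact hw.inv x h4 h3
  have := h1.to_local_left_inverse (hw.deriv_pos _ (hw.mem ξ hξ)).ne' hev
  rw [hw.eval ξ hξ] at this
  exact this.hasDerivAt

lemma hasDerivAt_eval (hw : Well q a b R φ) (F : ℝ[X]) {ξ : ℝ} (hξ : |ξ| < R) :
    HasDerivAt (fun ξ => F.eval (φ ξ)) (F.derivative.eval (φ ξ) / q.derivative.eval (φ ξ)) ξ := by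
  rw [div_eq_mul_inv]
  exact (F.hasDerivAt (φ ξ)).comp ξ (hw.hasDerivAt hξ)

lemma continuousAt_eval (hw : Well q a b R φ) (F : ℝ[X]) {ξ : ℝ} (hξ : |ξ| < R) :
    ContinuousAt (fun ξ => F.eval (φ ξ)) ξ :=
  (hw.hasDerivAt_eval F hξ).continuousAt

lemma continuousAt_deriv (hw : Well q a b R φ) (F : ℝ[X]) {ξ : ℝ} (hξ : |ξ| < R) :
    ContinuousAt (fun ξ => F.derivative.eval (φ ξ) / q.derivative.eval (φ ξ)) ξ :=
  (hw.continuousAt_eval _ hξ).div (hw.continuousAt_eval _ hξ)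
    (hw.deriv_pos _ (hw.mem ξ hξ)).ne'

end Well

/-- An autonomous scalar equation with positive periodic right-hand side has a global solution,
which is onto and quasi-periodic. -/
lemma exists_angle_solution {p : ℝ → ℝ} {T₀ : ℝ} (hT₀ : 0 < T₀) (hp : Continuous p)
    (hpos : ∀ t, 0 < p t) (hper : Function.Periodic p T₀) :
    ∃ Θ : ℝ → ℝ, (∀ s, HasDerivAt Θ (p (Θ s)) s) ∧ Function.Surjective Θ ∧
      ∃ T > 0, ∀ s, Θ (s + T) = Θ s + T₀ := by
  have hg : Continuous fun t => (p t)⁻¹ := hp.inv₀ fun t => (hpos t).ne'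
  have hgper : Function.Periodic (fun t => (p t)⁻¹) T₀ := fun t => by simp only [hper t]
  set τ : ℝ → ℝ := fun t => ∫ u in 0..t, (p u)⁻¹ with hτ
  have hd : ∀ t, HasDerivAt τ (p t)⁻¹ t := fun t => hg.integral_hasStrictDerivAt 0 t |>.hasDerivAt
  have hmono : StrictMono τ := strictMono_of_deriv_pos fun t => by
    rw [(hd t).deriv]; exact inv_pos.2 (hpos t)
  have hT : 0 < τ T₀ := by
    have := hmono hT₀
    simpa [hτ] using this
  have hadd : ∀ t, τ (t + T₀) = τ t + τ T₀ := fun t => by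
    simp only [hτ]
    rw [← integral_add_adjacent_intervals (hg.intervalIntegrable 0 t)
      (hg.intervalIntegrable t (t + T₀)), hgper.intervalIntegral_add_eq t 0, zero_add]
  have hcont : Continuous τ := continuous_iff_continuousAt.2 fun t => (hd t).continuousAt
  have hsurj : Function.Surjective τ := hcont.surjective
    (hgper.tendsto_atTop_intervalIntegral_of_pos hT hT₀)
    (hgper.tendsto_atBot_intervalIntegral_of_pos hT hT₀)
  set e := hmono.orderIsoOfSurjective τ hsurj with he
  have hes : ∀ s, τ (e.symm s) = s := fun s => e.apply_symm_apply s
  refine ⟨e.symm, fun s => ?_, e.symm.surjective, τ T₀, hT, fun s => ?_⟩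
  · have := HasDerivAt.of_local_left_inverse (f := τ) (g := e.symm) (a := s)
      e.symm.continuous.continuousAt (hd _) (inv_ne_zero (hpos _).ne')
      (Eventually.of_forall hes)
    rwa [inv_inv] at this
  · apply hmono.injective
    rw [hes, hadd, hes]

/-- A planar curve avoiding the origin has a differentiable polar angle. -/
lemma exists_polar_lift {ξ Y ξ' Y' : ℝ → ℝ} (hξ : ∀ t, HasDerivAt ξ (ξ' t) t)
    (hY : ∀ t, HasDerivAt Y (Y' t) t) (hξ' : Continuous ξ') (hY' : Continuous Y')
    {r : ℝ → ℝ} (hr : ∀ t, 0 < r t) (hr2 : ∀ t, r t ^ 2 = ξ t ^ 2 + Y t ^ 2) :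
    (∀ t, HasDerivAt r ((ξ t * ξ' t + Y t * Y' t) / r t) t) ∧
    ∃ θ : ℝ → ℝ, (∀ t, HasDerivAt θ ((ξ' t * Y t - ξ t * Y' t) / r t ^ 2) t) ∧
      ∀ t, ξ t = r t * sin (θ t) ∧ Y t = r t * cos (θ t) := by
  have hrs : r = fun t => √(ξ t ^ 2 + Y t ^ 2) := funext fun t => by
    rw [← hr2, Real.sqrt_sq (hr t).le]
  have hpos : ∀ t, 0 < ξ t ^ 2 + Y t ^ 2 := fun t => by rw [← hr2]; exact pow_pos (hr t) 2
  have hrd : ∀ t, HasDerivAt r ((ξ t * ξ' t + Y t * Y' t) / r t) t := fun t => by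
    have h0 : HasDerivAt (fun t => ξ t ^ 2 + Y t ^ 2) (2 * ξ t * ξ' t + 2 * Y t * Y' t) t := by
      simpa using ((hξ t).fun_pow 2).fun_add ((hY t).fun_pow 2)
    have h := h0.sqrt (hpos t).ne'
    rw [← hrs, ← congrFun hrs t] at h
    have := (hr t).ne'
    refine h.congr_deriv ?_
    field_simp
  refine ⟨hrd, ?_⟩
  set ω : ℝ → ℝ := fun t => (ξ' t * Y t - ξ t * Y' t) / r t ^ 2 with hω
  have cξ : Continuous ξ := continuous_iff_continuousAt.2 fun t => (hξ t).continuousAt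
  have cY : Continuous Y := continuous_iff_continuousAt.2 fun t => (hY t).continuousAt
  have cr : Continuous r := continuous_iff_continuousAt.2 fun t => (hrd t).continuousAt
  have cω : Continuous ω := by
    refine Continuous.div (by fun_prop) (by fun_prop) fun t => (pow_pos (hr t) 2).ne'
  set z : ℂ := ⟨Y 0, ξ 0⟩ with hz
  have hzr : ‖z‖ = r 0 := by
    rw [Complex.norm_eq_sqrt_sq_add_sq, hrs]
    simp only [hz]
    rw [add_comm]
  set θ : ℝ → ℝ := fun t => z.arg + ∫ u in 0..t, ω u with hθ
  have hθd : ∀ t, HasDerivAt θ (ω t) t := fun t =>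
    ((cω.integral_hasStrictDerivAt 0 t).hasDerivAt).const_add _
  have hθ0 : θ 0 = z.arg := by simp [hθ]
  have ha : ∀ t, HasDerivAt (fun t => ξ t / r t) (ω t * (Y t / r t)) t := fun t => by
    have := (hr t).ne'
    refine ((hξ t).div (hrd t) this).congr_deriv ?_
    simp only [hω]
    field_simp
    rw [hr2]
    ring
  have hb : ∀ t, HasDerivAt (fun t => Y t / r t) (-(ω t * (ξ t / r t))) t := fun t => by
    have := (hr t).ne'
    refine ((hY t).div (hrd t) this).congr_deriv ?_
    simp only [hω]
    field_simp
    rw [hr2]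
    ring
  have hN : ∀ t, ξ t / r t * sin (θ t) + Y t / r t * cos (θ t) =
      ξ 0 / r 0 * sin (θ 0) + Y 0 / r 0 * cos (θ 0) := fun t => by
    refine is_const_of_deriv_eq_zero (f := fun t => ξ t / r t * sin (θ t) + Y t / r t * cos (θ t))
      (fun s => ?_) (fun s => ?_) t 0
    · exact (((ha s).mul (hθd s).sin).add ((hb s).mul (hθd s).cos)).differentiableAt
    · refine (((ha s).fun_mul (hθd s).sin).fun_add ((hb s).fun_mul (hθd s).cos)).deriv.trans ?_
      ring
  have hD : ∀ t, ξ t / r t * cos (θ t) - Y t / r t * sin (θ t) =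
      ξ 0 / r 0 * cos (θ 0) - Y 0 / r 0 * sin (θ 0) := fun t => by
    refine is_const_of_deriv_eq_zero (f := fun t => ξ t / r t * cos (θ t) - Y t / r t * sin (θ t))
      (fun s => ?_) (fun s => ?_) t 0
    · exact (((ha s).mul (hθd s).cos).sub ((hb s).mul (hθd s).sin)).differentiableAt
    · refine (((ha s).fun_mul (hθd s).cos).fun_sub ((hb s).fun_mul (hθd s).sin)).deriv.trans ?_
      ring
  have h1 : ξ 0 = r 0 * sin (θ 0) := by
    rw [hθ0, ← hzr, Complex.norm_mul_sin_arg]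
  have h2 : Y 0 = r 0 * cos (θ 0) := by
    rw [hθ0, ← hzr, Complex.norm_mul_cos_arg]
  have h0 := (hr 0).ne'
  have e1 : ξ 0 / r 0 = sin (θ 0) := by rw [h1]; field_simp
  have e2 : Y 0 / r 0 = cos (θ 0) := by rw [h2]; field_simp
  refine ⟨θ, hθd, fun t => ?_⟩
  have n1 := hN t
  have d1 := hD t
  rw [e1, e2] at n1 d1
  have s1 := sin_sq_add_cos_sq (θ 0)
  have s2 := sin_sq_add_cos_sq (θ t)
  have ht := (hr t).ne'
  constructor
  · rw [mul_comm, ← div_eq_iff ht]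
    linear_combination (sin (θ t)) * n1 + cos (θ t) * d1 + sin (θ t) * s1 - ξ t / r t * s2
  · rw [mul_comm, ← div_eq_iff ht]
    linear_combination (cos (θ t)) * n1 - sin (θ t) * d1 + cos (θ t) * s1 - Y t / r t * s2

namespace Well

variable {q : ℝ[X]} {a b R : ℝ} {φ : ℝ → ℝ}

/-- A periodic solution of the radial equation gives a periodic orbit. -/
lemma isPeriodicOrbit (hw : Well q a b R φ) (F : ℝ[X]) {ε : ℝ} {ρ : ℝ → ℝ}
    (hper : Function.Periodic ρ (2 * π))
    (hρ : ∀ t, HasDerivAt ρ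
      (ε * radialField (fun ξ => F.eval (φ ξ)) ε (sin t) (cos t) (ρ t)) t)
    (h0 : ∀ t, 0 < ρ t) (hR : ∀ t, ρ t < R)
    (hden : ∀ t, 0 < ρ t - ε * F.eval (φ (ρ t * sin t)) * cos t) :
    IsPeriodicOrbit (lienard F.derivative (q * q.derivative) ε)
      (range fun t => (φ (ρ t * sin t),
        ρ t * cos t - ε * F.eval (φ (ρ t * sin t)))) := by
  have hm : ∀ t, |ρ t * sin t| < R := fun t => abs_mul_sin_lt (h0 t) (hR t) t
  have cρ : Continuous ρ := continuous_iff_continuousAt.2 fun t => (hρ t).continuousAt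
  have cev : ∀ P : ℝ[X], Continuous fun t => P.eval (φ (ρ t * sin t)) := fun P =>
    continuous_iff_continuousAt.2 fun t => ContinuousAt.comp (g := fun ξ => P.eval (φ ξ))
      (f := fun t => ρ t * sin t) (hw.continuousAt_eval P (hm t)) (by fun_prop)
  have cF := cev F
  have cq := cev q.derivative
  have hq : ∀ t, 0 < q.derivative.eval (φ (ρ t * sin t)) := fun t =>
    hw.deriv_pos _ (hw.mem _ (hm t))
  obtain ⟨Θ, hΘ, hsurj, T, hT, hΘT⟩ := exists_angle_solution
    (p := fun t => q.derivative.eval (φ (ρ t * sin t)) *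
      (ρ t - ε * F.eval (φ (ρ t * sin t)) * cos t) / ρ t) Real.two_pi_pos
    (Continuous.div (by fun_prop) cρ fun t => (h0 t).ne')
    (fun t => div_pos (mul_pos (hq t) (hden t)) (h0 t))
    (fun t => by simp only [hper t, sin_add_two_pi, cos_add_two_pi])
  refine ⟨fun s => (φ (ρ (Θ s) * sin (Θ s)),
    ρ (Θ s) * cos (Θ s) - ε * F.eval (φ (ρ (Θ s) * sin (Θ s)))), fun s => ?_, ⟨T, hT, fun s => ?_⟩,
    ?_, ?_⟩
  · set t := Θ s with ht
    have hρt := h0 t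
    have hdt := hden t
    have hqt := hq t
    have hev := hw.eval _ (hm t)
    have d1 : HasDerivAt (fun s => ρ (Θ s)) _ s := (hρ t).comp s (hΘ s)
    have d2 : HasDerivAt (fun s => ρ (Θ s) * sin (Θ s)) _ s := d1.fun_mul (hΘ s).sin
    have d3 : HasDerivAt (fun s => φ (ρ (Θ s) * sin (Θ s))) _ s := (hw.hasDerivAt (hm t)).comp s d2
    have d4 : HasDerivAt (fun s => F.eval (φ (ρ (Θ s) * sin (Θ s)))) _ s :=
      HasDerivAt.comp (h₂ := fun x => F.eval x) s (F.hasDerivAt _) d3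
    have d5 : HasDerivAt
        (fun s => ρ (Θ s) * cos (Θ s) - ε * F.eval (φ (ρ (Θ s) * sin (Θ s)))) _ s :=
      (d1.fun_mul (hΘ s).cos).fun_sub (d4.const_mul ε)
    refine (d3.prodMk d5).congr_deriv ?_
    simp only [lienard, ← ht, radialField, eval_mul, hev]
    generalize q.derivative.eval (φ (ρ t * sin t)) = Q at *
    generalize F.derivative.eval (φ (ρ t * sin t)) = F' at *
    generalize F.eval (φ (ρ t * sin t)) = Φ at *
    have e1 : Q⁻¹ * (ε * (-(Φ * (ρ t * sin t)) / (ρ t - ε * Φ * cos t)) *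
        (Q * (ρ t - ε * Φ * cos t) / ρ t) * sin t +
        ρ t * (cos t * (Q * (ρ t - ε * Φ * cos t) / ρ t))) = ρ t * cos t - ε * Φ := by
      have := hρt.ne'
      have := hdt.ne'
      have := hqt.ne'
      field_simp
      linear_combination (-ε * Φ) * sin_sq_add_cos_sq t
    have e2 : ε * (-(Φ * (ρ t * sin t)) / (ρ t - ε * Φ * cos t)) *
        (Q * (ρ t - ε * Φ * cos t) / ρ t) * cos t +
        ρ t * (-sin t * (Q * (ρ t - ε * Φ * cos t) / ρ t)) = -(ρ t * sin t * Q) := by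
      have := hρt.ne'
      have := hdt.ne'
      have := hqt.ne'
      field_simp
      ring
    rw [e1, e2, mul_assoc ε F']
  · simp only [hΘT, hper (Θ s), sin_add_two_pi, cos_add_two_pi]
  · obtain ⟨s₁, h₁⟩ := hsurj (π / 2)
    obtain ⟨s₂, h₂⟩ := hsurj (-(π / 2))
    refine ⟨s₁, s₂, fun h => ?_⟩
    have h3 := congrArg (fun p : ℝ × ℝ => q.eval p.1) h
    have e1 := hw.eval _ (hm (π / 2))
    have e2 := hw.eval _ (hm (-(π / 2)))
    simp only [h₁, h₂, e1, e2] at h3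
    rw [sin_neg, sin_pi_div_two] at h3
    linarith [h0 (π / 2), h0 (-(π / 2))]
  · exact (hsurj.range_comp (fun t => (φ (ρ t * sin t),
        ρ t * cos t - ε * F.eval (φ (ρ t * sin t))))).symm

/-- A periodic orbit lying close to the circle of radius `r₀` comes from the periodic solution
of the radial equation. -/
lemma isPeriodicOrbit_unique (hw : Well q a b R φ) (F : ℝ[X]) {A : ℝ → ℝ} {r₀ η κ ε s : ℝ}
    (hκ : 0 < κ) (hε : 0 < ε) (hs : s = 1 ∨ s = -1) (hA : Continuous A)
    (hAper : Function.Periodic A (2 * π))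
    (hE₁ : ∀ t r₁ r₂, |r₁ - r₀| ≤ η → |r₂ - r₀| ≤ η →
      |radialField (fun ξ => F.eval (φ ξ)) ε (sin t) (cos t) r₂
        - radialField (fun ξ => F.eval (φ ξ)) ε (sin t) (cos t) r₁ - A t * (r₂ - r₁)|
          ≤ κ * |r₂ - r₁|)
    (integral_A : ∫ t in -π..π, A t = 4 * π * κ * s)
    (hη : ∀ t r, |r - r₀| ≤ η →
      0 < r ∧ r < R ∧ 0 < r - ε * F.eval (φ (r * sin t)) * cos t)
    {ρ : ℝ → ℝ} (hper : Function.Periodic ρ (2 * π))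
    (hρ : ∀ t, HasDerivAt ρ
      (ε * radialField (fun ξ => F.eval (φ ξ)) ε (sin t) (cos t) (ρ t)) t)
    (hρr : ∀ t, |ρ t - r₀| ≤ η) {Γ : Set (ℝ × ℝ)}
    (hΓ : IsPeriodicOrbit (lienard F.derivative (q * q.derivative) ε) Γ)
    (hΓU : ∀ p ∈ Γ, p.1 ∈ Ioo a b ∧
      |√(q.eval p.1 ^ 2 + (p.2 + ε * F.eval p.1) ^ 2) - r₀| ≤ η) :
    Γ = range fun t => (φ (ρ t * sin t), ρ t * cos t - ε * F.eval (φ (ρ t * sin t))) := by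
  obtain ⟨γ, hγ, ⟨T, hT, hγT⟩, -, rfl⟩ := hΓ
  have hU := fun t => hΓU (γ t) (mem_range_self t)
  set x : ℝ → ℝ := fun t => (γ t).1 with hx
  set y : ℝ → ℝ := fun t => (γ t).2 with hy
  have dx : ∀ t, HasDerivAt x (y t) t := fun t =>
    (hasFDerivAt_fst (𝕜 := ℝ) (p := γ t)).comp_hasDerivAt t (hγ t)
  have dy : ∀ t, HasDerivAt y (-(q.eval (x t) * q.derivative.eval (x t))
      - ε * F.derivative.eval (x t) * y t) t := fun t => by
    have h := (hasFDerivAt_snd (𝕜 := ℝ) (p := γ t)).comp_hasDerivAt t (hγ t)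
    simp only [lienard, eval_mul] at h
    exact h
  have cx : Continuous x := continuous_iff_continuousAt.2 fun t => (dx t).continuousAt
  have cy : Continuous y := continuous_iff_continuousAt.2 fun t => (dy t).continuousAt
  set ξ : ℝ → ℝ := fun t => q.eval (x t) with hξ
  set Y : ℝ → ℝ := fun t => y t + ε * F.eval (x t) with hY
  set r : ℝ → ℝ := fun t => √(ξ t ^ 2 + Y t ^ 2) with hr
  have hrη : ∀ t, |r t - r₀| ≤ η := fun t => (hU t).2
  have hr0 : ∀ t, 0 < r t := fun t => (hη 0 _ (hrη t)).1
  have hr2 : ∀ t, r t ^ 2 = ξ t ^ 2 + Y t ^ 2 := fun t => Real.sq_sqrt (by positivity)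
  have dξ : ∀ t, HasDerivAt ξ (q.derivative.eval (x t) * y t) t := fun t =>
    (q.hasDerivAt (x t)).comp t (dx t)
  have dY : ∀ t, HasDerivAt Y (-(ξ t * q.derivative.eval (x t))) t := fun t => by
    have h : HasDerivAt (fun t => F.eval (x t)) _ t := (F.hasDerivAt (x t)).comp t (dx t)
    refine ((dy t).fun_add (h.const_mul ε)).congr_deriv ?_
    simp only [hξ]
    ring
  have cq' : Continuous fun t => q.derivative.eval (x t) := q.derivative.continuous.comp cx
  have cξ : Continuous ξ := q.continuous.comp cx
  obtain ⟨dr, θ, dθ, hθ⟩ := exists_polar_lift dξ dY (cq'.mul cy) (cξ.mul cq').neg hr0 hr2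
  have hξR : ∀ t, |r t * sin (θ t)| < R := fun t =>
    abs_mul_sin_lt (hr0 t) (hη 0 _ (hrη t)).2.1 _
  have hxφ : ∀ t, φ (r t * sin (θ t)) = x t := fun t => by
    rw [← (hθ t).1]
    refine hw.inv _ (hU t).1 ?_
    have := hξR t
    rwa [← (hθ t).1] at this
  have hden : ∀ t, 0 < r t - ε * F.eval (x t) * cos (θ t) := fun t => by
    have := (hη (θ t) _ (hrη t)).2.2
    rwa [hxφ] at this
  have hq' : ∀ t, 0 < q.derivative.eval (x t) := fun t => hw.deriv_pos _ (hU t).1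
  set ω : ℝ → ℝ := fun t => q.derivative.eval (x t) *
    (r t - ε * F.eval (x t) * cos (θ t)) / r t with hω
  have hωpos : ∀ t, 0 < ω t := fun t => div_pos (mul_pos (hq' t) (hden t)) (hr0 t)
  have hyY : ∀ t, y t = r t * cos (θ t) - ε * F.eval (x t) := fun t => by
    rw [← (hθ t).2]; simp only [hY]; ring
  have dθ' : ∀ t, HasDerivAt θ (ω t) t := fun t => by
    refine (dθ t).congr_deriv ?_
    rw [hyY t, (hθ t).1, (hθ t).2]
    simp only [hω]
    have := (hr0 t).ne'
    field_simp
    linear_combination (q.derivative.eval (x t) * r t) * sin_sq_add_cos_sq (θ t)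
  have dr' : ∀ t, HasDerivAt r (ω t * (ε *
      radialField (fun ξ => F.eval (φ ξ)) ε (sin (θ t)) (cos (θ t)) (r t))) t := fun t => by
    refine (dr t).congr_deriv ?_
    simp only [radialField, hxφ]
    rw [hyY t, (hθ t).1, (hθ t).2]
    simp only [hω]
    have h1 := (hr0 t).ne'
    have h2 := (hden t).ne'
    generalize r t - ε * F.eval (x t) * cos (θ t) = D at *
    field_simp
    ring
  have hrT : Function.Periodic r T := fun t => by
    simp only [hr, hξ, hY, hx, hy, hγT t]
  have hθT : ∀ t, ∃ k : ℤ, θ (t + T) = θ t + k * (2 * π) := fun t => by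
    have h1 := hθ t
    have h2 := hθ (t + T)
    have h3 : ξ (t + T) = ξ t := by simp only [hξ, hx, hγT t]
    have h4 : Y (t + T) = Y t := by simp only [hY, hx, hy, hγT t]
    rw [hrT, h3, h1.1, mul_right_inj' (hr0 t).ne'] at h2
    rw [h4, h1.2, mul_right_inj' (hr0 t).ne'] at h2
    have h5 : (θ (t + T) : Real.Angle) = θ t := Real.Angle.cos_sin_inj h2.2.symm h2.1.symm
    obtain ⟨k, hk⟩ := Real.Angle.angle_eq_iff_two_pi_dvd_sub.1 h5
    exact ⟨k, by linear_combination hk⟩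
  have hrρ := eq_periodic_solution_of_average
    (H := fun t r => radialField (fun ξ => F.eval (φ ξ)) ε (sin t) (cos t) r)
    hκ hε hs hA hAper hE₁ integral_A hper hρ hρr hT hωpos dθ' dr' hrη hrT hθT
  have hmono : StrictMono θ := strictMono_of_deriv_pos fun t => by
    rw [(dθ' t).deriv]; exact hωpos t
  have hstep : ∀ t, θ t + 2 * π ≤ θ (t + T) := fun t => by
    obtain ⟨k, hk⟩ := hθT t
    have h1 : θ t < θ (t + T) := hmono (by linarith)
    have h2 : (0 : ℝ) < k := by
      by_contra h
      nlinarith [Real.pi_pos]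
    have h3 : (1 : ℝ) ≤ k := by exact_mod_cast (by exact_mod_cast h2 : 0 < k)
    nlinarith [Real.pi_pos]
  have hup : ∀ n : ℕ, θ 0 + n * (2 * π) ≤ θ (n * T) := fun n => by
    induction n with
    | zero => simp
    | succ n ih =>
      have := hstep (n * T)
      rw [show (n : ℝ) * T + T = (n + 1 : ℕ) * T by push_cast; ring] at this
      push_cast at this ⊢
      linarith
  have hdown : ∀ n : ℕ, θ (-(n * T)) ≤ θ 0 - n * (2 * π) := fun n => by
    induction n with
    | zero => simp
    | succ n ih =>
      have := hstep (-((n + 1 : ℕ) * T))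
      rw [show -((n + 1 : ℕ) * T) + T = -(n * T) by push_cast; ring] at this
      push_cast at this ⊢
      linarith
  have cθ : Continuous θ := continuous_iff_continuousAt.2 fun t => (dθ' t).continuousAt
  have hsurj : Function.Surjective θ := fun c => by
    obtain ⟨n, hn⟩ := exists_nat_gt (|c - θ 0| / (2 * π))
    rw [div_lt_iff₀ Real.two_pi_pos] at hn
    have h := abs_le.1 hn.le
    exact mem_range_of_exists_le_of_exists_ge cθ ⟨_, (hdown n).trans (by linarith)⟩
      ⟨_, le_trans (by linarith) (hup n)⟩
  rw [← hsurj.range_comp (fun t => (φ (ρ t * sin t), ρ t * cos t - ε * F.eval (φ (ρ t * sin t))))]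
  congr 1
  funext t
  simp only [Function.comp_apply, ← hrρ t, hxφ, ← hyY t]
  rfl

/-- A simple zero of the Melnikov function gives, for small `ε`, a limit cycle. -/
theorem exists_isLimitCycle (hw : Well q a b R φ) (F : ℝ[X]) {r₀ α β : ℝ} (hr₀ : 0 < r₀)
    (hrR : r₀ < R) (hα : α < r₀) (hβ : r₀ < β) (hM : melnikov φ F r₀ = 0)
    (hM' : melnikovDeriv q φ F r₀ ≠ 0) :
    ∃ ε₀ > 0, ∀ ε, 0 < ε → ε ≤ ε₀ → ∃ Γ,
      IsLimitCycle (lienard F.derivative (q * q.derivative) ε) Γ ∧ Γ.Nonempty ∧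
      ∀ p ∈ Γ, p.1 ∈ Ioo a b ∧
        √(q.eval p.1 ^ 2 + (p.2 + ε * F.eval p.1) ^ 2) ∈ Ioo α β := by
  set Φ : ℝ → ℝ := fun ξ => F.eval (φ ξ) with hΦ
  set Φ' : ℝ → ℝ := fun ξ => F.derivative.eval (φ ξ) / q.derivative.eval (φ ξ) with hΦ'
  set A : ℝ → ℝ := fun t => -(Φ' (r₀ * sin t) * sin t ^ 2) with hA
  set h₀ : ℝ → ℝ := fun t => -(Φ (r₀ * sin t) * sin t) with hh₀
  have cΦ : ∀ {r}, 0 < r → r < R → Continuous fun t => Φ (r * sin t) := fun {r} h1 h2 =>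
    continuous_iff_continuousAt.2 fun t => ContinuousAt.comp (g := Φ) (f := fun t => r * sin t)
      (hw.continuousAt_eval F (abs_mul_sin_lt h1 h2 t)) (by fun_prop)
  have cΦ' : Continuous fun t => Φ' (r₀ * sin t) :=
    continuous_iff_continuousAt.2 fun t => ContinuousAt.comp (g := Φ') (f := fun t => r₀ * sin t)
      (hw.continuousAt_deriv F (abs_mul_sin_lt hr₀ hrR t)) (by fun_prop)
  have cA : Continuous A := (cΦ'.mul (by fun_prop)).neg
  have ch₀ : Continuous h₀ := ((cΦ hr₀ hrR).mul (by fun_prop)).neg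
  have Aper : Function.Periodic A (2 * π) := fun t => by simp only [hA, sin_add_two_pi]
  have hper : Function.Periodic h₀ (2 * π) := fun t => by simp only [hh₀, sin_add_two_pi]
  have integral_A : ∫ t in -π..π, A t = -melnikovDeriv q φ F r₀ := by
    simp only [hA, intervalIntegral.integral_neg]; rfl
  have integral_h₀ : ∫ t in -π..π, h₀ t = 0 := by
    simp only [hh₀, intervalIntegral.integral_neg]
    rw [neg_eq_zero]; exact hM
  obtain ⟨CA, hCA⟩ := (Aper.isBounded_of_continuous Real.two_pi_pos.ne' cA).exists_norm_le
  obtain ⟨Ch, hCh⟩ := (hper.isBounded_of_continuous Real.two_pi_pos.ne' ch₀).exists_norm_le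
  set C := max CA Ch with hC
  have hAC : ∀ t, |A t| ≤ C := fun t => (hCA _ (mem_range_self t)).trans (le_max_left _ _)
  have hhC : ∀ t, |h₀ t| ≤ C := fun t => (hCh _ (mem_range_self t)).trans (le_max_right _ _)
  have hC0 : 0 ≤ C := (abs_nonneg _).trans (hAC 0)
  obtain ⟨κ, s, hκ, hs, hκs⟩ : ∃ κ s : ℝ, 0 < κ ∧ (s = 1 ∨ s = -1) ∧
      -melnikovDeriv q φ F r₀ = 4 * π * κ * s := by
    have hπ := Real.pi_pos
    rcases lt_or_gt_of_ne hM' with h | h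
    · exact ⟨-melnikovDeriv q φ F r₀ / (4 * π), 1, div_pos (by linarith) (by linarith), Or.inl rfl,
        by field_simp⟩
    · exact ⟨melnikovDeriv q φ F r₀ / (4 * π), -1, div_pos (by linarith) (by linarith), Or.inr rfl,
        by field_simp⟩
  obtain ⟨δ₁, hδ₁, H₁⟩ := radialField_eventually (fun ξ hξ => hw.hasDerivAt_eval F hξ)
    (fun ξ hξ => hw.continuousAt_deriv F hξ) hr₀ hrR hκ
  set η := min δ₁ (min (r₀ - α) (β - r₀)) / 2 with hη
  have hη0 : 0 < η := half_pos (lt_min hδ₁ (lt_min (by linarith) (by linarith)))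
  have hη1 : η < δ₁ := by
    have := min_le_left δ₁ (min (r₀ - α) (β - r₀)); linarith
  have hη2 : η < r₀ - α := by
    have := (min_le_right δ₁ _).trans (min_le_left (r₀ - α) (β - r₀)); linarith
  have hη3 : η < β - r₀ := by
    have := (min_le_right δ₁ _).trans (min_le_right (r₀ - α) (β - r₀)); linarith
  set κ₂ := κ * η / 8 with hκ₂
  have hκ₂0 : 0 < κ₂ := by positivity
  obtain ⟨δ₂, hδ₂, H₂⟩ := radialField_eventually_close
    (fun ξ hξ => hw.continuousAt_eval F hξ) hr₀ hrR hκ₂0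
  have hsm : ∀ᶠ ε : ℝ in 𝓝 0, 2 * π * (ε * (C + κ₂ + (C + κ) * η)) < η / 2 ∧
      κ₂ + (C + κ) * (2 * π * (ε * (C + κ₂ + (C + κ) * η))) < κ * (η / 2) := by
    have c1 : ContinuousAt (fun ε : ℝ => 2 * π * (ε * (C + κ₂ + (C + κ) * η))) 0 := by fun_prop
    have c2 : ContinuousAt (fun ε : ℝ =>
      κ₂ + (C + κ) * (2 * π * (ε * (C + κ₂ + (C + κ) * η)))) 0 := by fun_prop
    refine (c1.eventually_lt_const ?_).and (c2.eventually_lt_const ?_)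
    · simpa using hη0
    · simp only [zero_mul, mul_zero, add_zero, hκ₂]
      have := mul_pos hκ hη0
      linarith
  obtain ⟨δ₃, hδ₃, H₃⟩ := Metric.eventually_nhds_iff.1 hsm
  have hδ : 0 < min δ₁ (min δ₂ δ₃) := lt_min hδ₁ (lt_min hδ₂ hδ₃)
  refine ⟨min δ₁ (min δ₂ δ₃) / 2, half_pos hδ, fun ε hε hεle => ?_⟩
  have hεlt : |ε| < min δ₁ (min δ₂ δ₃) := by rw [abs_of_pos hε]; linarith
  have hsin : ∀ t, sin t ∈ Icc (-1 : ℝ) 1 := sin_mem_Icc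
  have hcos : ∀ t, cos t ∈ Icc (-1 : ℝ) 1 := cos_mem_Icc
  have G₁ := H₁ ε (hεlt.trans_le (min_le_left _ _))
  have G₂ := H₂ ε (hεlt.trans_le ((min_le_right _ _).trans (min_le_left _ _)))
  obtain ⟨hs₁, hs₂⟩ := H₃ (y := ε) (by
    rw [Real.dist_eq, sub_zero]
    exact hεlt.trans_le ((min_le_right _ _).trans (min_le_right _ _)))
  have hgood : ∀ t r, |r - r₀| ≤ η →
      0 < r ∧ r < R ∧ 0 < r - ε * F.eval (φ (r * sin t)) * cos t := fun t r hr =>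
    (G₁ _ (hsin t) _ (hcos t)).1 r (hr.trans_lt hη1)
  have hE₁ : ∀ t r₁ r₂, |r₁ - r₀| ≤ η → |r₂ - r₀| ≤ η →
      |radialField Φ ε (sin t) (cos t) r₂ - radialField Φ ε (sin t) (cos t) r₁ -
        A t * (r₂ - r₁)| ≤ κ * |r₂ - r₁| := fun t r₁ r₂ h1 h2 =>
    (G₁ _ (hsin t) _ (hcos t)).2 r₁ r₂ (h1.trans_lt hη1) (h2.trans_lt hη1)
  obtain ⟨ρ, hρper, hρ, hρr⟩ := exists_periodic_solution_of_average
    (H := fun t r => radialField Φ ε (sin t) (cos t) r) (A := A) (h₀ := h₀) (s := s)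
    hη0 hκ hκ₂0.le hε hs (fun t r => by simp only [sin_add_two_pi, cos_add_two_pi])
    (fun r hr => by
      obtain ⟨g1, g2, -⟩ := hgood 0 r hr
      have := cΦ g1 g2
      exact (this.mul (by fun_prop)).neg.div
        (continuous_const.sub ((continuous_const.mul this).mul continuous_cos))
        fun t => (hgood t r hr).2.2.ne')
    cA ch₀ hAC hhC hE₁ (fun t => G₂ _ (hsin t) _ (hcos t)) integral_h₀ (integral_A.trans hκs) hs₁ hs₂
  have hρ' := fun t => hgood t (ρ t) (hρr t).le
  have horb := hw.isPeriodicOrbit F hρper hρ (fun t => (hρ' t).1) (fun t => (hρ' t).2.1)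
    (fun t => (hρ' t).2.2)
  set Γ := range fun t => (φ (ρ t * sin t), ρ t * cos t - ε * F.eval (φ (ρ t * sin t))) with hΓ
  have hΓmem : ∀ p ∈ Γ, p.1 ∈ Ioo a b ∧
      |√(q.eval p.1 ^ 2 + (p.2 + ε * F.eval p.1) ^ 2) - r₀| < η := by
    rintro _ ⟨t, rfl⟩
    have hm := abs_mul_sin_lt (hρ' t).1 (hρ' t).2.1 t
    refine ⟨hw.mem _ hm, ?_⟩
    simp only [hw.eval _ hm, sub_add_cancel]
    rw [show (ρ t * sin t) ^ 2 + (ρ t * cos t) ^ 2 = ρ t ^ 2 by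
      linear_combination (ρ t ^ 2) * sin_sq_add_cos_sq t, Real.sqrt_sq (hρ' t).1.le]
    exact hρr t
  refine ⟨Γ, ⟨horb, {p | p.1 ∈ Ioo a b ∧
      |√(q.eval p.1 ^ 2 + (p.2 + ε * F.eval p.1) ^ 2) - r₀| < η}, ?_, hΓmem, ?_⟩,
      range_nonempty _, fun p hp => ⟨(hΓmem p hp).1, ?_⟩⟩
  · have c1 : Continuous fun p : ℝ × ℝ => q.eval p.1 := q.continuous.comp continuous_fst
    have c2 : Continuous fun p : ℝ × ℝ => F.eval p.1 := F.continuous.comp continuous_fst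
    exact (isOpen_Ioo.preimage continuous_fst).inter
      (isOpen_lt (((c1.pow 2).add ((continuous_snd.add (c2.const_mul ε)).pow 2)).sqrt.sub
        continuous_const).abs continuous_const)
  · intro Γ' hΓ' hsub
    exact hw.isPeriodicOrbit_unique F hκ hε hs cA Aper hE₁ (integral_A.trans hκs) hgood hρper hρ
      (fun t => (hρr t).le) hΓ' fun p hp => ⟨(hsub hp).1, (hsub hp).2.le⟩
  · have := abs_lt.1 (hΓmem p hp).2
    exact ⟨by linarith, by linarith⟩

end Well

namespace Well

variable {q : ℝ[X]} {a b R : ℝ} {φ : ℝ → ℝ}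

lemma continuous_eval_mul_sin (hw : Well q a b R φ) (F : ℝ[X]) {r : ℝ} (h0 : 0 < r) (hr : r < R) :
    Continuous fun θ => F.eval (φ (r * sin θ)) * sin θ := by
  refine Continuous.mul ?_ continuous_sin
  exact continuous_iff_continuousAt.2 fun t => ContinuousAt.comp (g := fun ξ => F.eval (φ ξ))
    (f := fun t => r * sin t) (hw.continuousAt_eval F (abs_mul_sin_lt h0 hr t)) (by fun_prop)

lemma hasDerivAt_melnikov (hw : Well q a b R φ) (F : ℝ[X]) {r : ℝ} (h0 : 0 < r) (hr : r < R) :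
    HasDerivAt (melnikov φ F) (melnikovDeriv q φ F r) r := by
  set D : ℝ → ℝ := fun ξ => F.derivative.eval (φ ξ) / q.derivative.eval (φ ξ) with hD
  have hsub : Icc (-((r + R) / 2)) ((r + R) / 2) ⊆ {ξ | |ξ| < R} := fun ξ hξ => by
    have := abs_le.2 hξ
    exact this.trans_lt (by linarith)
  obtain ⟨C, hC⟩ := isCompact_Icc.exists_bound_of_continuousOn (f := D)
    fun ξ hξ => (hw.continuousAt_deriv F (hsub hξ)).continuousWithinAt
  have hs : Ioo (r / 2) ((r + R) / 2) ∈ 𝓝 r := Ioo_mem_nhds (by linarith) (by linarith)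
  have hbd : ∀ x ∈ Ioo (r / 2) ((r + R) / 2), ∀ θ, |x * sin θ| ≤ (r + R) / 2 := fun x hx θ => by
    rw [abs_mul, abs_of_pos (by linarith [hx.1])]
    nlinarith [abs_sin_le_one θ, abs_nonneg (sin θ), hx.1, hx.2]
  refine (intervalIntegral.hasDerivAt_integral_of_dominated_loc_of_deriv_le (μ := volume)
    (bound := fun _ => C)
    (F := fun x θ => F.eval (φ (x * sin θ)) * sin θ)
    (F' := fun x θ => D (x * sin θ) * sin θ ^ 2) hs ?_ ?_ ?_ ?_ ?_ ?_).2
  · filter_upwards [hs] with x hx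
    exact (hw.continuous_eval_mul_sin F (by linarith [hx.1])
      (by linarith [hx.2])).aestronglyMeasurable
  · exact (hw.continuous_eval_mul_sin F h0 hr).intervalIntegrable _ _
  · have : Continuous fun θ => D (r * sin θ) :=
      continuous_iff_continuousAt.2 fun t => ContinuousAt.comp (g := D)
        (f := fun t => r * sin t) (hw.continuousAt_deriv F (abs_mul_sin_lt h0 hr t)) (by fun_prop)
    exact (this.mul (continuous_sin.pow 2)).aestronglyMeasurable
  · refine Eventually.of_forall fun θ _ x hx => ?_
    have h1 := hC _ (abs_le.1 (hbd x hx θ))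
    rw [norm_mul, Real.norm_of_nonneg (sq_nonneg (sin θ))]
    have h2 : sin θ ^ 2 ≤ 1 := sin_sq_le_one θ
    exact (mul_le_of_le_one_right (norm_nonneg _) h2).trans h1
  · exact intervalIntegrable_const
  · refine Eventually.of_forall fun θ _ x hx => ?_
    have h1 : HasDerivAt (fun x => x * sin θ) (sin θ) x := by
      simpa using (hasDerivAt_id x).mul_const (sin θ)
    have h2 := (HasDerivAt.comp (h₂ := fun ξ => F.eval (φ ξ)) x
      (hw.hasDerivAt_eval F (hsub (abs_le.1 (hbd x hx θ)))) h1).mul_const (sin θ)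
    refine h2.congr_deriv ?_
    simp only [hD]
    ring

lemma melnikov_add (hw : Well q a b R φ) (F₁ F₂ : ℝ[X]) {r : ℝ} (h0 : 0 < r) (hr : r < R) :
    melnikov φ (F₁ + F₂) r = melnikov φ F₁ r + melnikov φ F₂ r := by
  simp only [melnikov, eval_add, add_mul]
  exact intervalIntegral.integral_add
    ((hw.continuous_eval_mul_sin F₁ h0 hr).intervalIntegrable _ _)
    ((hw.continuous_eval_mul_sin F₂ h0 hr).intervalIntegrable _ _)

end Well

lemma melnikov_C_mul (φ : ℝ → ℝ) (c : ℝ) (F : ℝ[X]) (r : ℝ) :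
    melnikov φ (C c * F) r = c * melnikov φ F r := by
  simp only [melnikov, eval_mul, eval_C, mul_assoc]
  exact intervalIntegral.integral_const_mul _ _

lemma eventually_nhdsGT_zero_iff {P : ℝ → Prop} :
    (∀ᶠ ε in 𝓝[>] 0, P ε) ↔ ∃ ε₀ > 0, ∀ ε, 0 < ε → ε ≤ ε₀ → P ε := by
  rw [Filter.eventually_iff, mem_nhdsGT_iff_exists_Ioc_subset]
  exact exists_congr fun u => and_congr_right fun _ =>
    ⟨fun h ε h1 h2 => h ⟨h1, h2⟩, fun h ε hε => h ε hε.1 hε.2⟩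

namespace Well

variable {q : ℝ[X]} {a b R : ℝ} {φ : ℝ → ℝ}

lemma strictMonoOn (hw : Well q a b R φ) : StrictMonoOn φ (Ioo (-R) R) := by
  refine strictMonoOn_of_deriv_pos (convex_Ioo _ _)
    (fun ξ hξ => (hw.hasDerivAt (abs_lt.2 hξ)).continuousAt.continuousWithinAt) fun ξ hξ => ?_
  rw [interior_Ioo] at hξ
  rw [(hw.hasDerivAt (abs_lt.2 hξ)).deriv]
  exact inv_pos.2 (hw.deriv_pos _ (hw.mem _ (abs_lt.2 hξ)))

lemma melnikov_X_pos (hw : Well q a b R φ) {r : ℝ} (h0 : 0 < r) (hr : r < R) :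
    0 < melnikov φ X r := by
  have hc := hw.continuous_eval_mul_sin X h0 hr
  simp only [eval_X] at hc
  have heq : melnikov φ X r = ∫ θ in -π..π, (φ (r * sin θ) - φ 0) * sin θ := by
    simp only [melnikov, eval_X, sub_mul]
    have hs : Continuous fun θ => φ 0 * sin θ := continuous_const.mul continuous_sin
    rw [intervalIntegral.integral_sub (hc.intervalIntegrable _ _) (hs.intervalIntegrable _ _),
      intervalIntegral.integral_const_mul, integral_sin]
    simp
  have hm : ∀ θ, r * sin θ ∈ Ioo (-R) R := fun θ => abs_lt.1 (abs_mul_sin_lt h0 hr θ)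
  have h00 : (0 : ℝ) ∈ Ioo (-R) R := ⟨by linarith, by linarith⟩
  rw [heq]
  refine intervalIntegral.integral_pos (by linarith [Real.pi_pos]) ?_ (fun θ _ => ?_)
    ⟨π / 2, ⟨by linarith [Real.pi_pos], by linarith [Real.pi_pos]⟩, ?_⟩
  · simp only [sub_mul]
    exact (hc.sub (continuous_const.mul continuous_sin)).continuousOn
  · rcases le_total 0 (sin θ) with h | h
    · refine mul_nonneg (sub_nonneg.2 (hw.strictMonoOn.monotoneOn h00 (hm θ) ?_)) h
      positivity
    · refine mul_nonneg_of_nonpos_of_nonpos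
        (sub_nonpos.2 (hw.strictMonoOn.monotoneOn (hm θ) h00 ?_)) h
      exact mul_nonpos_of_nonneg_of_nonpos h0.le h
  · have := hm (π / 2)
    rw [sin_pi_div_two, mul_one] at this ⊢
    rw [mul_one]
    exact sub_pos.2 (hw.strictMonoOn h00 this h0)

/-- By Sard's theorem, adding a generic multiple of `X` to `F` makes all zeros of the Melnikov
function simple. -/
lemma ae_melnikovDeriv_ne_zero (hw : Well q a b R φ) (F : ℝ[X]) :
    ∀ᵐ c : ℝ, ∀ r ∈ Ioo 0 R, melnikov φ (F + C c * X) r = 0 →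
      melnikovDeriv q φ (F + C c * X) r ≠ 0 := by
  set u : ℝ → ℝ := fun r => -(melnikov φ F r / melnikov φ X r) with hu
  set u' : ℝ → ℝ := fun r => -((melnikovDeriv q φ F r * melnikov φ X r -
    melnikov φ F r * melnikovDeriv q φ X r) / melnikov φ X r ^ 2) with hu'
  have hud : ∀ r ∈ Ioo 0 R, HasDerivAt u (u' r) r := fun r hr =>
    ((hw.hasDerivAt_melnikov F hr.1 hr.2).fun_div (hw.hasDerivAt_melnikov X hr.1 hr.2)
      (hw.melnikov_X_pos hr.1 hr.2).ne').fun_neg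
  have hz : volume (u '' {r ∈ Ioo 0 R | u' r = 0}) = 0 := by
    refine addHaar_image_eq_zero_of_det_fderivWithin_eq_zero volume
      (f' := fun r => ContinuousLinearMap.toSpanSingleton ℝ (u' r))
      (fun r hr => (hud r hr.1).hasFDerivAt.hasFDerivWithinAt) fun r hr => ?_
    rw [hr.2]
    simp
  have hae : ∀ᵐ c : ℝ, c ∉ u '' {r ∈ Ioo 0 R | u' r = 0} := measure_eq_zero_iff_ae_notMem.1 hz
  filter_upwards [hae] with c hc r hr hM hM'
  have hX := hw.melnikov_X_pos hr.1 hr.2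
  have hlin : ∀ s ∈ Ioo 0 R, melnikov φ (F + C c * X) s = melnikov φ F s + c * melnikov φ X s :=
    fun s hs => by rw [hw.melnikov_add _ _ hs.1 hs.2, melnikov_C_mul]
  have hd : melnikovDeriv q φ (F + C c * X) r =
      melnikovDeriv q φ F r + c * melnikovDeriv q φ X r := by
    refine (hw.hasDerivAt_melnikov _ hr.1 hr.2).unique (HasDerivAt.congr_of_eventuallyEq
      ((hw.hasDerivAt_melnikov F hr.1 hr.2).fun_add
        ((hw.hasDerivAt_melnikov X hr.1 hr.2).const_mul c)) ?_)
    filter_upwards [Ioo_mem_nhds hr.1 hr.2] with s hs using hlin s hs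
  rw [hlin r hr] at hM
  rw [hd] at hM'
  refine hc ⟨r, ⟨hr, ?_⟩, ?_⟩
  · simp only [hu', neg_eq_zero, div_eq_zero_iff]
    left
    linear_combination melnikov φ X r * hM' - melnikovDeriv q φ X r * hM
  · simp only [hu]
    field_simp
    linear_combination -hM

/-- If the Melnikov function has only simple zeros and alternates in sign along `N + 1` points,
then for small `ε` there are at least `N` limit cycles in the strip of the well. -/
lemma eventually_exists_finset (hw : Well q a b R φ) (F : ℝ[X]) {N : ℕ} {h : Fin (N + 1) → ℝ}
    (hmono : StrictMono h) (hh : ∀ i, h i ∈ Ioo 0 R)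
    (hsign : ∀ i : Fin N, melnikov φ F (h i.castSucc) * melnikov φ F (h i.succ) < 0)
    (hsimple : ∀ r ∈ Ioo 0 R, melnikov φ F r = 0 → melnikovDeriv q φ F r ≠ 0) :
    ∀ᶠ ε in 𝓝[>] 0, ∃ S : Finset (Set (ℝ × ℝ)), S.card = N ∧
      ∀ Γ ∈ S, IsLimitCycle (lienard F.derivative (q * q.derivative) ε) Γ ∧
        Γ.Nonempty ∧ ∀ p ∈ Γ, p.1 ∈ Ioo a b := by
  have hlt : ∀ i : Fin N, h i.castSucc < h i.succ := fun i => hmono i.castSucc_lt_succ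
  have hex : ∀ i : Fin N, ∃ r ∈ Ioo (h i.castSucc) (h i.succ), melnikov φ F r = 0 := fun i => by
    have hc : ContinuousOn (melnikov φ F) (Icc (h i.castSucc) (h i.succ)) := fun r hr =>
      (hw.hasDerivAt_melnikov F ((hh _).1.trans_le hr.1)
        (hr.2.trans_lt (hh _).2)).continuousAt.continuousWithinAt
    rcases mul_neg_iff.1 (hsign i) with ⟨h1, h2⟩ | ⟨h1, h2⟩
    · exact intermediate_value_Ioo' (hlt i).le hc ⟨h2, h1⟩
    · exact intermediate_value_Ioo (hlt i).le hc ⟨h1, h2⟩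
  have hev : ∀ᶠ ε in 𝓝[>] 0, ∀ i : Fin N, ∃ Γ,
      IsLimitCycle (lienard F.derivative (q * q.derivative) ε) Γ ∧ Γ.Nonempty ∧
      ∀ p ∈ Γ, p.1 ∈ Ioo a b ∧ √(q.eval p.1 ^ 2 + (p.2 + ε * F.eval p.1) ^ 2) ∈
        Ioo (h i.castSucc) (h i.succ) := by
    refine eventually_all.2 fun i => eventually_nhdsGT_zero_iff.2 ?_
    obtain ⟨r, hr, hr'⟩ := hex i
    have h0 := (hh i.castSucc).1.trans hr.1
    have hR := hr.2.trans (hh i.succ).2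
    exact hw.exists_isLimitCycle F h0 hR hr.1 hr.2 hr' (hsimple r ⟨h0, hR⟩ hr')
  filter_upwards [hev] with ε hε
  choose Γ hΓ hne hmem using hε
  have hdisj : ∀ i j : Fin N, i < j → Γ i ≠ Γ j := fun i j hij heq => by
    obtain ⟨p, hp⟩ := hne i
    have h1 := (hmem i p hp).2.2
    rw [heq] at hp
    have h2 := (hmem j p hp).2.1
    have h3 : h i.succ ≤ h j.castSucc := hmono.monotone (by
      rw [Fin.le_def]; simpa using hij)
    linarith
  have hinj : Function.Injective Γ := fun i j heq => by
    rcases lt_trichotomy i j with hij | hij | hij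
    · exact absurd heq (hdisj i j hij)
    · exact hij
    · exact absurd heq.symm (hdisj j i hij)
  refine ⟨Finset.univ.map ⟨Γ, hinj⟩, by simp, fun G hG => ?_⟩
  obtain ⟨i, -, rfl⟩ := Finset.mem_map.1 hG
  exact ⟨hΓ i, hne i, fun p hp => (hmem i p hp).1⟩

end Well

lemma exists_strictMono_interpolation {ι E : Type*} [LinearOrder ι] [AddCommGroup E] [Module ℝ E]
    [FiniteDimensional ℝ E] {N : ℕ} (hE : Module.finrank ℝ E = N) (L : E →ₗ[ℝ] ι → ℝ)
    (hL : Function.Injective L) :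
    ∃ h : Fin N → ι, StrictMono h ∧ ∀ w : Fin N → ℝ, ∃ v, ∀ i, L v (h i) = w i := by
  classical
  let e : ι → Module.Dual ℝ E := fun r => LinearMap.proj r ∘ₗ L
  have hspan : Submodule.span ℝ (Set.range e) = ⊤ := by
    apply Submodule.span_eq_top_of_ne_zero
    intro z hz
    have : L z ≠ 0 := fun h => hz (hL (by simpa using h))
    obtain ⟨r, hr⟩ := Function.ne_iff.1 this
    exact ⟨e r, ⟨r, rfl⟩, hr⟩
  obtain ⟨κ, a, ha, hs, hli⟩ := exists_linearIndependent' ℝ e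
  rw [hspan] at hs
  let B := Module.Basis.mk hli hs.ge
  have : Fintype κ := Module.Basis.fintypeIndexOfRankLtAleph0 B (Module.rank_lt_aleph0 ℝ _)
  have hκ : Fintype.card κ = N := by
    rw [← Module.finrank_eq_card_basis B, Subspace.dual_finrank_eq, hE]
  let s : Finset ι := Finset.univ.image a
  have hs' : s.card = N := by rw [Finset.card_image_of_injective _ ha, Finset.card_univ, hκ]
  refine ⟨s.orderEmbOfFin hs', (s.orderEmbOfFin hs').strictMono, ?_⟩
  let T : E →ₗ[ℝ] Fin N → ℝ := LinearMap.pi fun i => e (s.orderEmbOfFin hs' i)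
  have hT : Function.Injective T := by
    rw [← LinearMap.ker_eq_bot, LinearMap.ker_eq_bot']
    intro z hz
    have hzero : ∀ k, e (a k) z = 0 := fun k => by
      have : a k ∈ Set.range (s.orderEmbOfFin hs') := by
        rw [Finset.range_orderEmbOfFin]
        simp [s]
      obtain ⟨i, hi⟩ := this
      rw [← hi]
      exact congrFun hz i
    have : Module.Dual.eval ℝ E z = 0 := by
      apply B.ext
      intro k
      simpa [B] using hzero k
    rw [← map_zero (Module.Dual.eval ℝ E)] at this
    exact Module.eval_apply_injective ℝ this
  have hsurj := (LinearMap.injective_iff_surjective_of_finrank_eq_finrank (by simp [hE])).1 hT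
  intro w
  obtain ⟨v, hv⟩ := hsurj w
  exact ⟨v, fun i => congrFun hv i⟩

lemma integral_ne_zero_of_forall_ne_zero {u : ℝ → ℝ} (hu : Continuous u) {a b : ℝ} (hab : a < b)
    (h : ∀ x ∈ Ioo a b, u x ≠ 0) : ∫ x in a..b, u x ≠ 0 := by
  intro h0
  have hd : ∀ x, HasDerivAt (fun x => ∫ t in a..x, u t) (u x) x := fun x =>
    intervalIntegral.integral_hasDerivAt_right (hu.intervalIntegrable _ _)
      hu.stronglyMeasurable.stronglyMeasurableAtFilter hu.continuousAt
  obtain ⟨c, hc, hc'⟩ := exists_hasDerivAt_eq_zero hab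
    (fun x _ => (hd x).continuousAt.continuousWithinAt) (by simp [h0]) (fun x _ => hd x)
  exact h c hc hc'

namespace Well

variable {q : ℝ[X]} {a b R : ℝ} {φ : ℝ → ℝ}

lemma melnikov_eq_integral_sub (hw : Well q a b R φ) (F : ℝ[X]) {r : ℝ} (h0 : 0 < r) (hr : r < R) :
    melnikov φ F r =
      ∫ θ in 0..π, (F.eval (φ (r * sin θ)) * sin θ + F.eval (φ (r * sin (-θ))) * sin (-θ)) := by
  have hc := hw.continuous_eval_mul_sin F h0 hr
  have hc' : Continuous fun θ => F.eval (φ (r * sin (-θ))) * sin (-θ) := hc.comp continuous_neg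
  rw [melnikov, ← intervalIntegral.integral_add_adjacent_intervals (b := 0)
    (hc.intervalIntegrable _ _) (hc.intervalIntegrable _ _),
    intervalIntegral.integral_add (hc.intervalIntegrable _ _) (hc'.intervalIntegrable _ _),
    add_comm]
  congr 1
  rw [intervalIntegral.integral_comp_neg (fun θ => F.eval (φ (r * sin θ)) * sin θ), neg_zero]

lemma exists_melnikov_ne_zero (hw : Well q a b R φ) (hR : 0 < R) {F : ℝ[X]}
    (hF : ∀ᶠ ξ in 𝓝[>] 0, F.eval (φ ξ) ≠ F.eval (φ (-ξ))) :
    ∃ r ∈ Ioo 0 R, melnikov φ F r ≠ 0 := by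
  obtain ⟨r₀, hr₀, h⟩ := eventually_nhdsGT_zero_iff.1 hF
  have hr0 : 0 < min r₀ (R / 2) := lt_min hr₀ (by linarith)
  have hrR : min r₀ (R / 2) < R := (min_le_right _ _).trans_lt (by linarith)
  refine ⟨min r₀ (R / 2), ⟨hr0, hrR⟩, ?_⟩
  rw [hw.melnikov_eq_integral_sub F hr0 hrR]
  have hc := hw.continuous_eval_mul_sin F hr0 hrR
  refine integral_ne_zero_of_forall_ne_zero (hc.add (hc.comp continuous_neg)) Real.pi_pos
    fun θ hθ => ?_
  have hs := sin_pos_of_mem_Ioo hθ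
  simp only [Pi.add_apply, Function.comp_apply]
  rw [sin_neg, mul_neg, mul_neg, ← sub_eq_add_neg, ← sub_mul]
  refine mul_ne_zero (sub_ne_zero.2 (h _ (mul_pos hr0 hs) ?_)) hs.ne'
  exact (mul_le_of_le_one_right hr0.le (sin_le_one θ)).trans (min_le_left _ _)

/-- A family of dimension `N + 1` without identically vanishing Melnikov functions contains
a member whose Melnikov function has prescribed values at suitable points. -/
lemma exists_melnikov_eq (hw : Well q a b R φ) {E : Type*} [AddCommGroup E] [Module ℝ E]
    [FiniteDimensional ℝ E] {N : ℕ} (hE : Module.finrank ℝ E = N) (P : E →ₗ[ℝ] ℝ[X])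
    (hP : ∀ v ≠ 0, ∃ r ∈ Ioo 0 R, melnikov φ (P v) r ≠ 0) :
    ∃ h : Fin N → ℝ, StrictMono h ∧ (∀ i, h i ∈ Ioo 0 R) ∧
      ∀ w : Fin N → ℝ, ∃ v, ∀ i, melnikov φ (P v) (h i) = w i := by
  let L : E →ₗ[ℝ] Ioo 0 R → ℝ :=
    { toFun := fun v r => melnikov φ (P v) r
      map_add' := fun v w => by
        ext r
        simp only [map_add, Pi.add_apply]
        exact hw.melnikov_add _ _ r.2.1 r.2.2
      map_smul' := fun c v => by
        ext r
        simp [smul_eq_C_mul, melnikov_C_mul] }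
  have hL : Function.Injective L := by
    rw [← LinearMap.ker_eq_bot, LinearMap.ker_eq_bot']
    intro v hv
    by_contra hne
    obtain ⟨r, hr, hr'⟩ := hP v hne
    exact hr' (congrFun hv ⟨r, hr⟩)
  obtain ⟨h, hm, hh⟩ := exists_strictMono_interpolation hE L hL
  exact ⟨fun i => h i, hm, fun i => (h i).2, hh⟩

end Well

lemma eventually_eval_ne_zero {p : ℝ[X]} (hp : p ≠ 0) (x : ℝ) : ∀ᶠ z in 𝓝[≠] x, p.eval z ≠ 0 :=
  nhdsNE_le_cofinite x (p.finite_setOfPred_isRoot hp).compl_mem_cofinite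

lemma eq_zero_of_comp_eq_zero {p s : ℝ[X]} (hs : s.natDegree ≠ 0) (h : p.comp s = 0) : p = 0 := by
  rcases comp_eq_zero_iff.1 h with h | ⟨-, h⟩
  · exact h
  · rw [h, natDegree_C] at hs
    exact absurd rfl hs

lemma natDegree_le_of_mem_degreeLT_succ {p : ℝ[X]} {m : ℕ} (hp : p ∈ degreeLT ℝ (m + 1)) :
    p.natDegree ≤ m := by
  rw [mem_degreeLT, degree_lt_iff_coeff_zero] at hp
  exact natDegree_le_iff_coeff_eq_zero.2 fun k hk => hp k hk

lemma finrank_degreeLT (m : ℕ) : Module.finrank ℝ (degreeLT ℝ m) = m := by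
  rw [(degreeLTEquiv ℝ m).finrank_eq, Module.finrank_fin_fun]

instance (m : ℕ) : FiniteDimensional ℝ (degreeLT ℝ m) :=
  (degreeLTEquiv ℝ m).symm.finiteDimensional

/-- The potential `cubic ^ 2 / 2` has three wells. -/
noncomputable def cubic : ℝ[X] := X ^ 3 - X

lemma eval_cubic (x : ℝ) : cubic.eval x = x ^ 3 - x := by simp [cubic]

lemma eval_derivative_cubic (x : ℝ) : cubic.derivative.eval x = 3 * x ^ 2 - 1 := by
  simp only [cubic, derivative_sub, derivative_X_pow, derivative_X, eval_sub, eval_mul, eval_C,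
    eval_pow, eval_X, eval_one]
  norm_num

lemma natDegree_cubic : cubic.natDegree = 3 := by
  rw [cubic]
  compute_degree!

lemma natDegree_cubic_sq : (cubic ^ 2).natDegree = 6 := by
  rw [natDegree_pow, natDegree_cubic]

lemma natDegree_cubic_mul_derivative_le : (cubic * cubic.derivative).natDegree ≤ 5 := by
  refine natDegree_mul_le.trans ?_
  have := natDegree_derivative_le cubic
  rw [natDegree_cubic] at *
  omega

lemma exists_well_right : ∃ φ, Well cubic (3 / 5) 2 (3 / 8) φ := by
  refine exists_well (by norm_num) (fun x hx => ?_) ?_ ?_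
  · rw [eval_derivative_cubic]
    nlinarith [hx.1]
  · rw [eval_cubic]; norm_num
  · rw [eval_cubic]; norm_num

lemma exists_well_center : ∃ φ, Well (-cubic) (-(1 / 2)) (1 / 2) (3 / 8) φ := by
  refine exists_well (by norm_num) (fun x hx => ?_) ?_ ?_
  · rw [derivative_neg, eval_neg, eval_derivative_cubic]
    nlinarith [hx.1, hx.2]
  · rw [eval_neg, eval_cubic]; norm_num
  · rw [eval_neg, eval_cubic]; norm_num

lemma Well.reflect {φ : ℝ → ℝ} {a b R : ℝ} (hw : Well cubic a b R φ) :
    Well cubic (-b) (-a) R fun ξ => -φ (-ξ) where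
  mem ξ hξ := by
    have := hw.mem (-ξ) (by rwa [abs_neg])
    exact ⟨neg_lt_neg this.2, neg_lt_neg this.1⟩
  eval ξ hξ := by
    have := hw.eval (-ξ) (by rwa [abs_neg])
    rw [eval_cubic] at this ⊢
    linear_combination -this
  inv x hx hx' := by
    have h : cubic.eval (-x) = -cubic.eval x := by rw [eval_cubic, eval_cubic]; ring
    have := hw.inv (-x) ⟨by linarith [hx.2], by linarith [hx.1]⟩ (by rwa [h, abs_neg])
    rw [← h, this, neg_neg]
  deriv_pos x hx := by
    have := hw.deriv_pos (-x) ⟨by linarith [hx.2], by linarith [hx.1]⟩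
    rw [eval_derivative_cubic] at this ⊢
    linarith [neg_sq x]

lemma melnikov_reflect (φ : ℝ → ℝ) {F : ℝ[X]} (hF : ∀ x, F.eval (-x) = F.eval x) (r : ℝ) :
    melnikov (fun ξ => -φ (-ξ)) F r = -melnikov φ F r := by
  simp only [melnikov, hF]
  have h := intervalIntegral.integral_comp_neg (a := -π) (b := π)
    (fun θ => F.eval (φ (r * sin θ)) * sin θ)
  rw [neg_neg] at h
  rw [← h, ← intervalIntegral.integral_neg]
  simp

lemma Well.map_neg_center {φ : ℝ → ℝ} {b R : ℝ} (hw : Well (-cubic) (-b) b R φ) {ξ : ℝ}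
    (hξ : |ξ| < R) : φ (-ξ) = -φ ξ := by
  have h1 := hw.mem ξ hξ
  have h2 : (-cubic).eval (-φ ξ) = -ξ := by
    have := hw.eval ξ hξ
    rw [eval_neg, eval_cubic] at this ⊢
    linear_combination -this
  have := hw.inv (-φ ξ) ⟨neg_lt_neg h1.2, by linarith [h1.1]⟩ (by rwa [h2, abs_neg])
  rwa [h2] at this

lemma Well.melnikov_eq_zero_center {φ : ℝ → ℝ} {b R : ℝ} (hw : Well (-cubic) (-b) b R φ) {F : ℝ[X]}
    (hF : ∀ x, F.eval (-x) = F.eval x) {r : ℝ} (h0 : 0 < r) (hr : r < R) : melnikov φ F r = 0 := by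
  rw [hw.melnikov_eq_integral_sub F h0 hr]
  have : ∀ θ, F.eval (φ (r * sin θ)) * sin θ + F.eval (φ (r * sin (-θ))) * sin (-θ) = 0 := by
    intro θ
    rw [sin_neg, mul_neg, mul_neg, hw.map_neg_center (abs_mul_sin_lt h0 hr θ), hF]
    ring
  simp only [this, intervalIntegral.integral_zero]

/-- The even polynomials used in the outer wells. -/
noncomputable def evenFamily (m k : ℕ) : degreeLT ℝ m × degreeLT ℝ k →ₗ[ℝ] ℝ[X] where
  toFun v := (v.1 : ℝ[X]).comp (cubic ^ 2) * X ^ 2 + (v.2 : ℝ[X]).comp (cubic ^ 2) * X ^ 4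
  map_add' v w := by
    simp only [Prod.fst_add, Prod.snd_add, Submodule.coe_add, add_comp]
    ring
  map_smul' c v := by
    simp only [Prod.smul_fst, Prod.smul_snd, Submodule.coe_smul, smul_comp, RingHom.id_apply,
      smul_add, smul_mul_assoc]

lemma eval_evenFamily {m k : ℕ} (v : degreeLT ℝ m × degreeLT ℝ k) (x : ℝ) :
    (evenFamily m k v).eval x = (v.1 : ℝ[X]).eval ((x ^ 3 - x) ^ 2) * x ^ 2 +
      (v.2 : ℝ[X]).eval ((x ^ 3 - x) ^ 2) * x ^ 4 := by
  simp [evenFamily, eval_cubic]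

lemma eval_evenFamily_neg {m k : ℕ} (v : degreeLT ℝ m × degreeLT ℝ k) (x : ℝ) :
    (evenFamily m k v).eval (-x) = (evenFamily m k v).eval x := by
  have : ((-x) ^ 3 - -x) ^ 2 = (x ^ 3 - x) ^ 2 := by ring
  rw [eval_evenFamily, eval_evenFamily, this]
  ring

lemma natDegree_evenFamily_le {m k : ℕ} (v : degreeLT ℝ (m + 1) × degreeLT ℝ (k + 1)) :
    (evenFamily (m + 1) (k + 1) v).natDegree ≤ max (6 * m + 2) (6 * k + 4) := by
  have h1 := natDegree_le_of_mem_degreeLT_succ v.1.2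
  have h2 := natDegree_le_of_mem_degreeLT_succ v.2.2
  refine (natDegree_add_le _ _).trans (max_le_max ?_ ?_)
  · refine natDegree_mul_le.trans ?_
    rw [natDegree_comp, natDegree_cubic_sq, natDegree_X_pow]
    omega
  · refine natDegree_mul_le.trans ?_
    rw [natDegree_comp, natDegree_cubic_sq, natDegree_X_pow]
    omega

lemma comp_add_comp_mul_ne_zero {b c : ℝ[X]} (h : b ≠ 0 ∨ c ≠ 0) :
    b.comp (cubic ^ 2) + c.comp (cubic ^ 2) * (2 - X ^ 2) ≠ 0 := by
  intro h0
  have hs : (cubic ^ 2).natDegree ≠ 0 := by rw [natDegree_cubic_sq]; norm_num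
  have hd : (X ^ 2 - 2 : ℝ[X]).natDegree = 2 := by compute_degree!
  have h1 : b.comp (cubic ^ 2) = c.comp (cubic ^ 2) * (X ^ 2 - 2) := by linear_combination h0
  have hc : c = 0 := by
    by_contra hc
    have h2 := congrArg natDegree h1
    rw [natDegree_mul (fun h => hc (eq_zero_of_comp_eq_zero hs h))
      (fun h => by simp [h] at hd), hd, natDegree_comp, natDegree_comp, natDegree_cubic_sq] at h2
    omega
  rw [hc, zero_comp, zero_mul] at h1
  exact h.elim (· (eq_zero_of_comp_eq_zero hs h1)) (· hc)

lemma Well.exists_melnikov_evenFamily_ne_zero {φ : ℝ → ℝ} {a b R : ℝ} (hw : Well cubic a b R φ)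
    (ha : 0 < a) (hR : 0 < R) {m k : ℕ} {v : degreeLT ℝ m × degreeLT ℝ k} (hv : v ≠ 0) :
    ∃ r ∈ Ioo 0 R, melnikov φ (evenFamily m k v) r ≠ 0 := by
  apply hw.exists_melnikov_ne_zero hR
  have hQ := comp_add_comp_mul_ne_zero (b := v.1) (c := v.2) (by
    by_contra! h
    exact hv (Prod.ext (Subtype.ext h.1) (Subtype.ext h.2)))
  have hmem : ∀ᶠ ξ in 𝓝[>] (0 : ℝ), ξ ∈ Ioo 0 R := Ioo_mem_nhdsGT hR
  have hlt : ∀ ξ ∈ Ioo 0 R, φ (-ξ) < φ ξ := fun ξ hξ =>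
    hw.strictMonoOn ⟨by linarith [hξ.2], by linarith [hξ.1]⟩
      ⟨by linarith [hξ.1], hξ.2⟩ (by linarith [hξ.1])
  have hφ : ContinuousAt φ 0 := (hw.hasDerivAt (by simpa using hR)).continuousAt
  have hz : Tendsto (fun ξ => φ (-ξ) - φ ξ) (𝓝[>] 0) (𝓝[≠] 0) := by
    refine tendsto_nhdsWithin_iff.2 ⟨?_, ?_⟩
    · have h1 : ContinuousAt (fun ξ => φ (-ξ) - φ ξ) 0 :=
        (ContinuousAt.comp (g := φ) (f := fun ξ => -ξ) (by simpa using hφ)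
          continuousAt_neg).sub hφ
      have h2 : Tendsto (fun ξ => φ (-ξ) - φ ξ) (𝓝 0) (𝓝 0) := by simpa [ContinuousAt] using h1
      exact h2.mono_left nhdsWithin_le_nhds
    · filter_upwards [hmem] with ξ hξ
      exact (sub_neg.2 (hlt ξ hξ)).ne
  filter_upwards [hz.eventually (eventually_eval_ne_zero hQ 0), hmem] with ξ h1 h2
  have habs : |ξ| < R := by rw [abs_of_pos h2.1]; exact h2.2
  have hx := hw.eval ξ habs
  have hy := hw.eval (-ξ) (by rwa [abs_neg])
  have hxp := ha.trans (hw.mem ξ habs).1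
  have hyp := ha.trans (hw.mem (-ξ) (by rwa [abs_neg])).1
  have hlt := hlt ξ h2
  rw [eval_cubic] at hx hy
  simp only [eval_add, eval_mul, eval_comp, eval_pow, eval_sub, eval_X, eval_ofNat, eval_cubic]
    at h1
  rw [eval_evenFamily, eval_evenFamily, hx, hy, neg_sq]
  generalize φ ξ = x at *
  generalize φ (-ξ) = y at *
  have hxy : x * y = x ^ 2 + y ^ 2 - 1 := by
    have : (x + y) * (x * y - (x ^ 2 + y ^ 2 - 1)) = 0 := by linear_combination -hx - hy
    rcases mul_eq_zero.1 this with h | h <;> linarith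
  have hzz : 2 - (y - x) ^ 2 = x ^ 2 + y ^ 2 := by linear_combination 2 * hxy
  have hzξ : (y - x) ^ 3 - (y - x) = ξ := by
    linear_combination hx / 2 - hy / 2 + 3 / 2 * (x - y) * hxy
  rw [hzz, hzξ] at h1
  intro h
  have : (x ^ 2 - y ^ 2) * ((v.1 : ℝ[X]).eval (ξ ^ 2) + (v.2 : ℝ[X]).eval (ξ ^ 2) *
    (x ^ 2 + y ^ 2)) = 0 := by linear_combination h
  rcases mul_eq_zero.1 this with h | h
  · nlinarith
  · exact h1 h

/-- The odd polynomials used in the central well. -/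
noncomputable def oddFamily (m : ℕ) : degreeLT ℝ m →ₗ[ℝ] ℝ[X] where
  toFun v := X * (v : ℝ[X]).comp (X ^ 2)
  map_add' v w := by
    simp only [Submodule.coe_add, add_comp]
    ring
  map_smul' c v := by
    simp only [Submodule.coe_smul, smul_comp, RingHom.id_apply, mul_smul_comm]

lemma natDegree_oddFamily_le {m : ℕ} (v : degreeLT ℝ (m + 1)) :
    (oddFamily (m + 1) v).natDegree ≤ 2 * m + 1 := by
  have h1 := natDegree_le_of_mem_degreeLT_succ v.2
  refine natDegree_mul_le.trans ?_
  rw [natDegree_comp, natDegree_X_pow, natDegree_X]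
  omega

lemma Well.exists_melnikov_oddFamily_ne_zero {φ : ℝ → ℝ} {b R : ℝ}
    (hw : Well (-cubic) (-b) b R φ) (hR : 0 < R) {m : ℕ} {v : degreeLT ℝ m} (hv : v ≠ 0) :
    ∃ r ∈ Ioo 0 R, melnikov φ (oddFamily m v) r ≠ 0 := by
  apply hw.exists_melnikov_ne_zero hR
  have hQ : oddFamily m v ≠ 0 := fun h => by
    rcases mul_eq_zero.1 h with h | h
    · exact X_ne_zero h
    · exact hv (Subtype.ext (eq_zero_of_comp_eq_zero (by rw [natDegree_X_pow]; norm_num) h))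
  have hmem : ∀ᶠ ξ in 𝓝[>] (0 : ℝ), ξ ∈ Ioo 0 R := Ioo_mem_nhdsGT hR
  have h0 : φ 0 = 0 := by
    have := hw.map_neg_center (ξ := 0) (by simpa using hR)
    rw [neg_zero] at this
    linarith
  have hz : Tendsto φ (𝓝[>] 0) (𝓝[≠] 0) := by
    refine tendsto_nhdsWithin_iff.2 ⟨?_, ?_⟩
    · have h1 : ContinuousAt φ 0 := (hw.hasDerivAt (by simpa using hR)).continuousAt
      rw [ContinuousAt, h0] at h1
      exact h1.mono_left nhdsWithin_le_nhds
    · filter_upwards [hmem] with ξ hξ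
      have := hw.strictMonoOn ⟨by linarith, hR⟩ ⟨by linarith [hξ.1], hξ.2⟩ hξ.1
      rw [h0] at this
      exact this.ne'
  filter_upwards [hz.eventually (eventually_eval_ne_zero hQ 0), hmem] with ξ h1 h2
  have hodd : ∀ x, (oddFamily m v).eval (-x) = -(oddFamily m v).eval x := fun x => by
    simp [oddFamily]
  rw [hw.map_neg_center (by rw [abs_of_pos h2.1]; exact h2.2), hodd]
  exact fun h => h1 (by linarith)

lemma exists_finset_union₃ {α β : Type*} {p : Set α → Prop} {x : α → β} {s₁ s₂ s₃ : Set β}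
    (h₁₂ : Disjoint s₁ s₂) (h₁₃ : Disjoint s₁ s₃) (h₂₃ : Disjoint s₂ s₃) {S₁ S₂ S₃ : Finset (Set α)}
    (h₁ : ∀ Γ ∈ S₁, p Γ ∧ Γ.Nonempty ∧ ∀ z ∈ Γ, x z ∈ s₁)
    (h₂ : ∀ Γ ∈ S₂, p Γ ∧ Γ.Nonempty ∧ ∀ z ∈ Γ, x z ∈ s₂)
    (h₃ : ∀ Γ ∈ S₃, p Γ ∧ Γ.Nonempty ∧ ∀ z ∈ Γ, x z ∈ s₃) :
    ∃ S : Finset (Set α), (∀ Γ ∈ S, p Γ) ∧ S.card = S₁.card + S₂.card + S₃.card := by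
  classical
  have key : ∀ {s t : Set β} {S T : Finset (Set α)}, Disjoint s t →
      (∀ Γ ∈ S, p Γ ∧ Γ.Nonempty ∧ ∀ z ∈ Γ, x z ∈ s) →
      (∀ Γ ∈ T, p Γ ∧ Γ.Nonempty ∧ ∀ z ∈ Γ, x z ∈ t) → Disjoint S T := by
    intro s t S T hst hS hT
    rw [Finset.disjoint_left]
    intro Γ h h'
    obtain ⟨-, ⟨z, hz⟩, h1⟩ := hS Γ h
    exact Set.disjoint_left.1 hst (h1 z hz) ((hT Γ h').2.2 z hz)
  refine ⟨S₁ ∪ S₂ ∪ S₃, fun Γ hΓ => ?_, ?_⟩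
  · simp only [Finset.mem_union] at hΓ
    rcases hΓ with (h | h) | h
    exacts [(h₁ Γ h).1, (h₂ Γ h).1, (h₃ Γ h).1]
  · rw [Finset.card_union_of_disjoint, Finset.card_union_of_disjoint (key h₁₂ h₁ h₂)]
    exact Finset.disjoint_union_left.2 ⟨key h₁₃ h₁ h₃, key h₂₃ h₂ h₃⟩

/-- The Melnikov function of `F` changes sign between consecutive points `h i`. -/
def MelnikovAlternates (φ : ℝ → ℝ) (F : ℝ[X]) {N : ℕ} (h : Fin (N + 1) → ℝ) : Prop :=
  ∀ i : Fin N, melnikov φ F (h i.castSucc) * melnikov φ F (h i.succ) < 0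

lemma melnikovAlternates_of_eq_neg_one_pow {φ : ℝ → ℝ} {F : ℝ[X]} {N : ℕ} {h : Fin (N + 1) → ℝ}
    (hF : ∀ i, melnikov φ F (h i) = (-1) ^ (i : ℕ)) : MelnikovAlternates φ F h := by
  intro i
  rw [hF, hF, Fin.val_castSucc, Fin.val_succ, ← pow_add,
    (show Odd ((i : ℕ) + (i + 1)) from ⟨i, by ring⟩).neg_one_pow]
  norm_num

lemma MelnikovAlternates.reflect {φ : ℝ → ℝ} {F : ℝ[X]} {N : ℕ} {h : Fin (N + 1) → ℝ}
    (hF : MelnikovAlternates φ F h) (heven : ∀ x, F.eval (-x) = F.eval x) :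
    MelnikovAlternates (fun ξ => -φ (-ξ)) F h := by
  intro i
  rw [melnikov_reflect φ heven, melnikov_reflect φ heven, neg_mul_neg]
  exact hF i

namespace Well

variable {q : ℝ[X]} {a b R : ℝ} {φ : ℝ → ℝ}

lemma eventually_melnikovAlternates_add (hw : Well q a b R φ) {F : ℝ[X]} (G : ℝ[X]) {N : ℕ}
    {h : Fin (N + 1) → ℝ} (hh : ∀ i, h i ∈ Ioo 0 R) (hF : MelnikovAlternates φ F h) :
    ∀ᶠ δ in 𝓝 (0 : ℝ), MelnikovAlternates φ (F + C δ * G) h := by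
  refine eventually_all.2 fun i => ?_
  have heq : ∀ (j : Fin (N + 1)) (δ : ℝ),
      melnikov φ (F + C δ * G) (h j) = melnikov φ F (h j) + δ * melnikov φ G (h j) := fun j δ => by
    rw [hw.melnikov_add _ _ (hh j).1 (hh j).2, melnikov_C_mul]
  simp only [heq]
  have hc : Continuous fun δ : ℝ =>
      (melnikov φ F (h i.castSucc) + δ * melnikov φ G (h i.castSucc)) *
        (melnikov φ F (h i.succ) + δ * melnikov φ G (h i.succ)) := by fun_prop
  exact hc.continuousAt.eventually_lt_const (by simpa using hF i)

/-- An even polynomial does not contribute in the central well. -/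
lemma melnikovAlternates_add_center {b R : ℝ} (hw : Well (-cubic) (-b) b R φ) {F G : ℝ[X]}
    (hF : ∀ x, F.eval (-x) = F.eval x) {N : ℕ} {h : Fin (N + 1) → ℝ} (hh : ∀ i, h i ∈ Ioo 0 R)
    (hG : MelnikovAlternates φ G h) {δ : ℝ} (hδ : δ ≠ 0) :
    MelnikovAlternates φ (F + C δ * G) h := by
  intro i
  have heq : ∀ j, melnikov φ (F + C δ * G) (h j) = δ * melnikov φ G (h j) := fun j => by
    rw [hw.melnikov_add _ _ (hh j).1 (hh j).2, melnikov_C_mul,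
      hw.melnikov_eq_zero_center hF (hh j).1 (hh j).2, zero_add]
  rw [heq, heq]
  nlinarith [hG i, mul_pos_of_neg_of_neg (neg_neg_of_pos (pow_pos (abs_pos.2 hδ) 2)) (hG i),
    sq_abs δ]

end Well

lemma exists_polynomial_card_limitCycles (m k l : ℕ) :
    ∃ F : ℝ[X], F.natDegree ≤ max (max (6 * m + 2) (6 * k + 4)) (2 * l + 1) ∧
      ∃ ε₀ > 0, ∀ ε, 0 < ε → ε ≤ ε₀ → ∃ S : Finset (Set (ℝ × ℝ)),
        (∀ Γ ∈ S, IsLimitCycle (lienard F.derivative (cubic * cubic.derivative) ε) Γ) ∧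
          S.card = 2 * (m + k + 1) + l := by
  obtain ⟨φ, hw⟩ := exists_well_right
  obtain ⟨ψ, hw₀⟩ := exists_well_center
  have hw' := hw.reflect
  have hR : (0 : ℝ) < 3 / 8 := by norm_num
  obtain ⟨h, hmono, hh, hv⟩ := hw.exists_melnikov_eq (N := m + k + 1 + 1)
    (by rw [Module.finrank_prod, finrank_degreeLT, finrank_degreeLT]; ring)
    (evenFamily (m + 1) (k + 1))
    fun v hv => hw.exists_melnikov_evenFamily_ne_zero (by norm_num) hR hv
  obtain ⟨v, hv⟩ := hv fun i => (-1) ^ (i : ℕ)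
  obtain ⟨h₀, hmono₀, hh₀, hu⟩ := hw₀.exists_melnikov_eq (finrank_degreeLT (l + 1))
    (oddFamily (l + 1)) fun u hu => hw₀.exists_melnikov_oddFamily_ne_zero hR hu
  obtain ⟨u, hu⟩ := hu fun i => (-1) ^ (i : ℕ)
  have halt := melnikovAlternates_of_eq_neg_one_pow hv
  have halt₀ := melnikovAlternates_of_eq_neg_one_pow hu
  have heven := eval_evenFamily_neg v
  have hdegv := natDegree_evenFamily_le v
  have hdegu := natDegree_oddFamily_le u
  generalize evenFamily (m + 1) (k + 1) v = Fe at *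
  generalize oddFamily (l + 1) u = Fo at *
  obtain ⟨δ, ⟨hδ, hδ'⟩, hδ0⟩ := (((hw.eventually_melnikovAlternates_add Fo hh halt).and
    (hw'.eventually_melnikovAlternates_add Fo hh (halt.reflect heven))).filter_mono
      nhdsWithin_le_nhds |>.and (self_mem_nhdsWithin (s := {0}ᶜ))).exists
  have hδ₀ := hw₀.melnikovAlternates_add_center heven hh₀ halt₀ hδ0
  have hdeg : (Fe + C δ * Fo).natDegree ≤ max (max (6 * m + 2) (6 * k + 4)) (2 * l + 1) :=
    (natDegree_add_le _ _).trans (max_le_max hdegv ((natDegree_C_mul_le _ _).trans hdegu))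
  generalize Fe + C δ * Fo = F at *
  obtain ⟨c, ⟨hc, hc', hc₀⟩, ⟨hs, hs'⟩, hs₀⟩ := (Measure.dense_of_ae
    ((hw.ae_melnikovDeriv_ne_zero F).and ((hw'.ae_melnikovDeriv_ne_zero F).and
      (hw₀.ae_melnikovDeriv_ne_zero F)))).inter_nhds_nonempty
    (((hw.eventually_melnikovAlternates_add X hh hδ).and
      (hw'.eventually_melnikovAlternates_add X hh hδ')).and
      (hw₀.eventually_melnikovAlternates_add X hh₀ hδ₀))
  refine ⟨F + C c * X, (natDegree_add_le _ _).trans (max_le hdeg ?_), ?_⟩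
  · refine (natDegree_C_mul_le _ _).trans ?_
    rw [natDegree_X]
    exact le_max_of_le_right (by omega)
  · have e₁ := hw.eventually_exists_finset _ hmono hh hs hc
    have e₂ := hw'.eventually_exists_finset _ hmono hh hs' hc'
    have e₃ := hw₀.eventually_exists_finset _ hmono₀ hh₀ hs₀ hc₀
    rw [derivative_neg, neg_mul_neg] at e₃
    refine eventually_nhdsGT_zero_iff.1 ?_
    filter_upwards [e₁, e₂, e₃] with ε ⟨S₁, hS₁, h₁⟩ ⟨S₂, hS₂, h₂⟩ ⟨S₃, hS₃, h₃⟩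
    obtain ⟨S, hS, hcard⟩ := exists_finset_union₃ (x := Prod.fst)
      (Set.disjoint_left.2 fun x hx hx' => by linarith [hx.1, hx'.2])
      (Set.disjoint_left.2 fun x hx hx' => by linarith [hx.1, hx'.2])
      (Set.disjoint_left.2 fun x hx hx' => by linarith [hx.2, hx'.1]) h₁ h₂ h₃
    exact ⟨S, hS, by rw [hcard, hS₁, hS₂, hS₃]; ring⟩

lemma hGe_of_five_le {n m : ℕ} (hn : 3 ≤ n) (hm : 5 ≤ m) :
    HGe n m ((2 * ((n - 1) / 3) + (n - 1) / 2 : ℕ) : ℝ) := by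
  obtain ⟨F, hF, ε₀, hε₀, h⟩ :=
    exists_polynomial_card_limitCycles ((n - 1) / 6) ((n - 3) / 6) (n / 2)
  refine ⟨F.derivative, cubic * cubic.derivative, ?_, natDegree_cubic_mul_derivative_le.trans hm,
    ε₀, hε₀, fun ε h1 h2 => ?_⟩
  · have := natDegree_derivative_le F
    omega
  · obtain ⟨S, hS, hcard⟩ := h ε h1 h2
    refine ⟨S, hS, ?_⟩
    rw [hcard, Nat.cast_le]
    omega

theorem stmt1 (n : ℕ) (hn : 3 ≤ n) :
    HGe n 5 ((2 * ((n - 1) / 3) + (n - 1) / 2 : ℕ) : ℝ) ∧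
    HGe n 6 ((2 * ((n - 1) / 3) + (n - 1) / 2 : ℕ) : ℝ) := by
  exact ⟨hGe_of_five_le hn le_rfl, hGe_of_five_le hn (by norm_num)⟩
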